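/- Suppose ψ ∈ L¹(ℝ^d). Let ν be the smooth cut-off function used to define the discrete Riesz kernel z, let μ be the Schwartz function with μ̂(ξ) = ν(ξ b), and let λ be a Schwartz function with λ̂ supported in C₀ b^{-1} and λ̂(0) = 1. If s ∈ h¹ then Z * ( Σ_{k∈ℤ^d} s_k (ψ * λ * μ)(x − bk) ) = Σ_{k∈ℤ^d} (z * s)_k (ψ * λ)(x − bk), and this function belongs to L¹(ℝ^d). Equivalently, the Riesz transform of the synthesized function Σ_k s_k (ψ*λ*μ)(·−bk) equals the function synthesized from the discrete Riesz transform z*s of the coefficients with synthesizer ψ*λ. -/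

import Mathlib

open MeasureTheory Filter Matrix Set
open scoped ENNReal NNReal Topology

noncomputable section

namespace AffinePaper

/-- Embed an integer lattice point `k ∈ ℤ^d` into `ℝ^d`. -/
def intVec {d : ℕ} (k : Fin d → ℤ) : Fin d → ℝ := fun i => (k i : ℝ)

/-- Euclidean norm `|x|` on `ℝ^d`. -/
def eucNorm {d : ℕ} (x : Fin d → ℝ) : ℝ := Real.sqrt (∑ i, x i ^ 2)

/-- The constant `C_d = Γ((d+1)/2) π^{-(d+1)/2}` of the Riesz kernel. -/
def rieszConst (d : ℕ) : ℝ :=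
  Real.Gamma (((d : ℝ) + 1) / 2) / Real.pi ^ (((d : ℝ) + 1) / 2)

/-- The (vector-valued) Riesz kernel `Z(x) = C_d x / |x|^{d+1}`, with `Z(0) = 0`. -/
def rieszKernel (d : ℕ) (x : Fin d → ℝ) : Fin d → ℝ :=
  if x = 0 then 0 else fun i => rieszConst d * x i / eucNorm x ^ (d + 1)

/-- The truncated singular integral `∫_{|y| > ε} f(x-y) Z(y) dy` (vector-valued). -/
def truncRiesz {d : ℕ} (f : (Fin d → ℝ) → ℂ) (x : Fin d → ℝ) (ε : ℝ) : Fin d → ℂ :=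
  ∫ y in {y : Fin d → ℝ | ε < eucNorm y}, (fun i => f (x - y) * ((rieszKernel d y i : ℝ) : ℂ))

/-- `g` is the Riesz transform `Rf = f * Z` of `f`, in the principal value sense:
for a.e. `x` the truncated integrals converge to `g(x)` as `ε → 0+`. -/
def HasRiesz {d : ℕ} (f : (Fin d → ℝ) → ℂ) (g : (Fin d → ℝ) → Fin d → ℂ) : Prop :=
  ∀ᵐ x : Fin d → ℝ, Tendsto (fun ε : ℝ => truncRiesz f x ε) (𝓝[>] 0) (𝓝 (g x))

/-- Membership in the Hardy space `H¹(ℝ^d) = { f ∈ L¹ : Rf ∈ L¹ }`. -/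
def MemH1 {d : ℕ} (f : (Fin d → ℝ) → ℂ) : Prop :=
  Integrable f volume ∧ ∃ g : (Fin d → ℝ) → Fin d → ℂ, Integrable g volume ∧ HasRiesz f g

/-- The Hardy norm `‖f‖_{H¹} = ‖f‖₁ + ‖Rf‖₁`, as a value in `[0,∞]` (equal to `∞` when
`f` admits no integrable Riesz transform; the Riesz transform is a.e. unique, so the
infimum below is over a set of at most one value). -/
def hardyNorm {d : ℕ} (f : (Fin d → ℝ) → ℂ) : ℝ≥0∞ :=
  ENNReal.ofReal (∫ x : Fin d → ℝ, ‖f x‖) +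
    sInf {r : ℝ≥0∞ | ∃ g : (Fin d → ℝ) → Fin d → ℂ,
      Integrable g volume ∧ HasRiesz f g ∧ r = ENNReal.ofReal (∫ x : Fin d → ℝ, ‖g x‖)}

/-- The centered open unit cube `C₀ = (-1/2, 1/2)^d`. -/
def centeredCube (d : ℕ) : Set (Fin d → ℝ) :=
  Set.univ.pi fun _ => Set.Ioo (-(1/2) : ℝ) (1/2)

/-- `ν` is a smooth cut-off function: supported in the centered unit cube `C₀` and
identically `1` near the origin. -/
structure IsCutoff (d : ℕ) (ν : (Fin d → ℝ) → ℝ) : Prop where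
  smooth : ContDiff ℝ (⊤ : ℕ∞) ν
  supp : tsupport ν ⊆ centeredCube d
  one_near_zero : ∀ᶠ ξ in 𝓝 0, ν ξ = 1

/-- The periodic function `ζ(ξ) = -i (ξ b⁻¹ / |ξ b⁻¹|) ν(ξ)` (vector-valued), whose Fourier
coefficients define the discrete Riesz kernel. -/
def zetaFn {d : ℕ} (b : Matrix (Fin d) (Fin d) ℝ) (ν : (Fin d → ℝ) → ℝ)
    (ξ : Fin d → ℝ) : Fin d → ℂ :=
  fun i => -Complex.I * ((((ξ ᵥ* b⁻¹) i / eucNorm (ξ ᵥ* b⁻¹) : ℝ)) : ℂ) * ((ν ξ : ℝ) : ℂ)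

/-- The discrete Riesz kernel `z = {z_k}`, defined through its Fourier series
`Σ_k z_k e^{-2πi ξ k} = ζ(ξ)`, `ξ ∈ C₀`; that is, `z_k = ∫_{C₀} ζ(ξ) e^{2πi ξ k} dξ`. -/
def zKernel {d : ℕ} (b : Matrix (Fin d) (Fin d) ℝ) (ν : (Fin d → ℝ) → ℝ)
    (k : Fin d → ℤ) : Fin d → ℂ :=
  ∫ ξ in centeredCube d,
    Complex.exp (((2 * Real.pi * ∑ i, ξ i * (k i : ℝ) : ℝ)) * Complex.I) • zetaFn b ν ξ

/-- Discrete convolution `(s * z)_k = Σ_l s_{k-l} z_l` of a scalar sequence with the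
(vector-valued) kernel `z`, in the `k`-index. -/
def dConv {d : ℕ} (s : (Fin d → ℤ) → ℂ) (z : (Fin d → ℤ) → Fin d → ℂ)
    (k : Fin d → ℤ) : Fin d → ℂ :=
  ∑' l : Fin d → ℤ, s (k - l) • z l

/-- The discrete Hardy norm `‖s‖_{h¹} = ‖s‖_{ℓ¹} + ‖s * z‖_{ℓ¹}` (value in `[0,∞]`). -/
def h1Norm {d : ℕ} (b : Matrix (Fin d) (Fin d) ℝ) (ν : (Fin d → ℝ) → ℝ)
    (s : (Fin d → ℤ) → ℂ) : ℝ≥0∞ :=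
  (∑' k : Fin d → ℤ, (‖s k‖₊ : ℝ≥0∞)) +
    ∑' k : Fin d → ℤ, (‖dConv s (zKernel b ν) k‖₊ : ℝ≥0∞)

/-- The mixed norm `‖c‖_{ℓ¹(h¹)} = Σ_j ‖c_j‖_{h¹}` (value in `[0,∞]`). -/
def l1h1Norm {d : ℕ} (b : Matrix (Fin d) (Fin d) ℝ) (ν : (Fin d → ℝ) → ℝ)
    (c : ℕ → (Fin d → ℤ) → ℂ) : ℝ≥0∞ :=
  ∑' j : ℕ, h1Norm b ν (c j)

/-- `ψ_{j,k}(x) = |det a_j| ψ(a_j x - bk)` for isotropic dilations `a_j = α_j I`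
(Hardy-space normalization, `p = 1`). -/
def rescH {d : ℕ} (α : ℕ → ℝ) (b : Matrix (Fin d) (Fin d) ℝ) (ψ : (Fin d → ℝ) → ℂ)
    (j : ℕ) (k : Fin d → ℤ) (x : Fin d → ℝ) : ℂ :=
  ((|α j| ^ d : ℝ) : ℂ) * ψ (α j • x - b *ᵥ intVec k)

/-- The synthesis series `Sc = Σ_j Σ_k c_{j,k} ψ_{j,k}` converges to `f` in `H¹`:
for each `j` the sum over `k` converges absolutely in `L¹` to a function belonging to
`H¹`, and the sum over `j` converges absolutely in `H¹`, with limit `f`. -/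
def H1SynthesisTo {d : ℕ} (α : ℕ → ℝ) (b : Matrix (Fin d) (Fin d) ℝ)
    (ψ : (Fin d → ℝ) → ℂ) (c : ℕ → (Fin d → ℤ) → ℂ) (f : (Fin d → ℝ) → ℂ) : Prop :=
  (∀ j : ℕ, Summable fun k : Fin d → ℤ => ∫ x : Fin d → ℝ, ‖c j k * rescH α b ψ j k x‖) ∧
  (∀ j : ℕ, MemH1 (fun x => ∑' k : Fin d → ℤ, c j k * rescH α b ψ j k x)) ∧
  Summable (fun j : ℕ =>
    (hardyNorm (fun x => ∑' k : Fin d → ℤ, c j k * rescH α b ψ j k x)).toReal) ∧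
  Tendsto (fun J : ℕ => hardyNorm
      (fun x => f x - ∑ j ∈ Finset.range J, ∑' k : Fin d → ℤ, c j k * rescH α b ψ j k x))
    atTop (𝓝 0)

/-- Analysis operator at scale `j` in the Hardy-space setting (`p = 1`, `q = ∞`):
`(T_j f)_k = |det b| ⟨f, φ_{j,k}⟩` with `φ_{j,k}(x) = φ(α_j x - bk)`. -/
def TjH {d : ℕ} (α : ℕ → ℝ) (b : Matrix (Fin d) (Fin d) ℝ) (φ : (Fin d → ℝ) → ℂ)
    (f : (Fin d → ℝ) → ℂ) (j : ℕ) (k : Fin d → ℤ) : ℂ :=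
  ((|b.det| : ℝ) : ℂ) *
    ∫ x : Fin d → ℝ, f x * (starRingEnd ℂ) (φ (α j • x - b *ᵥ intVec k))

/-- Dot product of row vector `ξ` and column vector `x`. -/
def dotP {d : ℕ} (ξ x : Fin d → ℝ) : ℝ := ∑ i, ξ i * x i

/-- Fourier transform `f̂(ξ) = ∫ f(x) e^{-2πi ξ x} dx`. -/
def ft {d : ℕ} (f : (Fin d → ℝ) → ℂ) (ξ : Fin d → ℝ) : ℂ :=
  ∫ x : Fin d → ℝ, Complex.exp ((-(2 * Real.pi * dotP ξ x) : ℝ) * Complex.I) * f x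

/-- Inverse Fourier transform `ǧ(x) = ∫ g(ξ) e^{2πi ξ x} dξ`. -/
def ftInv {d : ℕ} (g : (Fin d → ℝ) → ℂ) (x : Fin d → ℝ) : ℂ :=
  ∫ ξ : Fin d → ℝ, Complex.exp (((2 * Real.pi * dotP ξ x) : ℝ) * Complex.I) * g ξ

/-- `f` is a Schwartz function. -/
def IsSchwartz {d : ℕ} (f : (Fin d → ℝ) → ℂ) : Prop :=
  ∃ Φ : SchwartzMap (Fin d → ℝ) ℂ, ∀ x, f x = Φ x

/-- Convolution `(f * g)(x) = ∫ f(y) g(x - y) dy`. -/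
def conv {d : ℕ} (f g : (Fin d → ℝ) → ℂ) (x : Fin d → ℝ) : ℂ :=
  ∫ y : Fin d → ℝ, f y * g (x - y)

/-- The periodization `Pg(x) = |det b| Σ_{k ∈ ℤ^d} g(x - bk)` of a real-valued function. -/
def periodization {d : ℕ} (b : Matrix (Fin d) (Fin d) ℝ) (g : (Fin d → ℝ) → ℝ)
    (x : Fin d → ℝ) : ℝ :=
  |b.det| * ∑' k : Fin d → ℤ, g (x - b *ᵥ intVec k)

/-- The character `x ↦ e^{2πi ξx}`. -/
def expChar {d : ℕ} (ξ x : Fin d → ℝ) : ℂ :=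
  Complex.exp (((2 * Real.pi * dotP ξ x : ℝ) : ℂ) * Complex.I)

/-- The kernel `y_j e^{-πt|y|²}`. -/
def gaussMoment {d : ℕ} (j : Fin d) (t : ℝ) (y : Fin d → ℝ) : ℝ :=
  y j * Real.exp (-(Real.pi * t * eucNorm y ^ 2))

/-- The symbol `-i ξ_j / |ξ|` of the `j`-th Riesz transform. -/
def rieszSymbol {d : ℕ} (j : Fin d) (ξ : Fin d → ℝ) : ℂ :=
  -Complex.I * ((ξ j / eucNorm ξ : ℝ) : ℂ)

section EucNorm

variable {d : ℕ}

lemma eucNorm_eq_norm (x : Fin d → ℝ) : eucNorm x = ‖WithLp.toLp 2 x‖ := by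
  rw [EuclideanSpace.norm_eq, eucNorm]
  simp

lemma eucNorm_nonneg (x : Fin d → ℝ) : 0 ≤ eucNorm x := Real.sqrt_nonneg _

lemma eucNorm_sq (x : Fin d → ℝ) : eucNorm x ^ 2 = ∑ i, x i ^ 2 :=
  Real.sq_sqrt (Finset.sum_nonneg fun i _ => sq_nonneg (x i))

lemma eucNorm_neg (x : Fin d → ℝ) : eucNorm (-x) = eucNorm x := by
  simp [eucNorm]

@[fun_prop]
lemma continuous_eucNorm : Continuous (eucNorm : (Fin d → ℝ) → ℝ) := by
  unfold eucNorm; fun_prop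

lemma abs_apply_le_eucNorm (x : Fin d → ℝ) (i : Fin d) : |x i| ≤ eucNorm x := by
  refine Real.abs_le_sqrt ?_
  exact Finset.single_le_sum (f := fun i => x i ^ 2) (fun i _ => sq_nonneg (x i))
    (Finset.mem_univ i)

lemma norm_le_eucNorm (x : Fin d → ℝ) : ‖x‖ ≤ eucNorm x :=
  (pi_norm_le_iff_of_nonneg (eucNorm_nonneg x)).2 fun i => abs_apply_le_eucNorm x i

lemma eucNorm_pos {x : Fin d → ℝ} (hx : x ≠ 0) : 0 < eucNorm x :=
  (norm_pos_iff.2 hx).trans_le (norm_le_eucNorm x)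

end EucNorm

section ExpChar

variable {d : ℕ}

lemma continuous_dotP : Continuous (fun p : (Fin d → ℝ) × (Fin d → ℝ) => dotP p.1 p.2) := by
  unfold dotP; fun_prop

lemma continuous_expChar :
    Continuous (fun p : (Fin d → ℝ) × (Fin d → ℝ) => expChar p.1 p.2) := by
  have := continuous_dotP (d := d)
  unfold expChar; fun_prop

@[fun_prop]
lemma Continuous.expChar {X : Type*} [TopologicalSpace X] {f g : X → Fin d → ℝ}
    (hf : Continuous f) (hg : Continuous g) : Continuous fun x => expChar (f x) (g x) :=
  continuous_expChar.comp (hf.prodMk hg)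

@[simp]
lemma norm_expChar (ξ x : Fin d → ℝ) : ‖expChar ξ x‖ = 1 := by
  rw [expChar, Complex.norm_exp_ofReal_mul_I]

lemma expChar_add (ξ x y : Fin d → ℝ) : expChar ξ (x + y) = expChar ξ x * expChar ξ y := by
  simp only [expChar, dotP, ← Complex.exp_add, Pi.add_apply, mul_add, Finset.sum_add_distrib]
  push_cast
  ring_nf

lemma expChar_sub (ξ x y : Fin d → ℝ) : expChar ξ (x - y) = expChar ξ x * expChar ξ (-y) := by
  rw [sub_eq_add_neg, expChar_add]

lemma ft_eq_integral_expChar (f : (Fin d → ℝ) → ℂ) (ξ : Fin d → ℝ) :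
    ft f ξ = ∫ x, expChar ξ (-x) * f x := by
  simp only [ft, expChar, dotP]
  simp

lemma expChar_mulVec (b : Matrix (Fin d) (Fin d) ℝ) (ξ x : Fin d → ℝ) :
    expChar ξ (b *ᵥ x) = expChar (ξ ᵥ* b) x := by
  have : dotP ξ (b *ᵥ x) = dotP (ξ ᵥ* b) x := dotProduct_mulVec ξ b x
  rw [expChar, expChar, this]

end ExpChar

section RieszKernel

variable {d : ℕ}

lemma measurable_rieszKernel (j : Fin d) : Measurable fun y => rieszKernel d y j := by
  have : (fun y => rieszKernel d y j) =
      fun y => if y = 0 then 0 else rieszConst d * y j / eucNorm y ^ (d + 1) := by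
    ext y; unfold rieszKernel; split_ifs <;> simp
  rw [this]
  have := (continuous_eucNorm (d := d)).measurable
  exact Measurable.ite (measurableSet_singleton 0) measurable_const (by fun_prop)

lemma rieszKernel_neg (y : Fin d → ℝ) (j : Fin d) :
    rieszKernel d (-y) j = -rieszKernel d y j := by
  unfold rieszKernel
  by_cases h : y = 0
  · simp [h]
  · simp [h, eucNorm_neg, neg_div]

lemma rieszConst_pos : 0 < rieszConst d := by
  unfold rieszConst
  have : 0 < Real.Gamma (((d : ℝ) + 1) / 2) := Real.Gamma_pos_of_pos (by positivity)
  positivity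

lemma abs_rieszKernel_le (y : Fin d → ℝ) (j : Fin d) :
    |rieszKernel d y j| ≤ rieszConst d / eucNorm y ^ d := by
  have hc := rieszConst_pos (d := d)
  have hn := eucNorm_nonneg y
  unfold rieszKernel
  by_cases h : y = 0
  · simp only [h, if_true, Pi.zero_apply, abs_zero]
    rw [h] at hn
    positivity
  · have hp := eucNorm_pos h
    simp only [h, if_false]
    rw [abs_div, abs_mul, abs_of_pos hc, abs_of_pos (pow_pos hp _), div_le_div_iff₀ (by positivity)
      (by positivity), pow_succ]
    have := abs_apply_le_eucNorm y j
    nlinarith [mul_le_mul_of_nonneg_left this (mul_pos hc (pow_pos hp d)).le]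

lemma abs_rieszKernel_le_of_lt {ε : ℝ} (hε : 0 < ε) {y : Fin d → ℝ} (hy : ε < eucNorm y)
    (j : Fin d) : |rieszKernel d y j| ≤ rieszConst d / ε ^ d := by
  refine (abs_rieszKernel_le y j).trans ?_
  have := rieszConst_pos (d := d)
  gcongr

/-- Gaussian subordination of the Riesz kernel. -/
lemma integral_gaussMoment_mul_rpow (j : Fin d) (y : Fin d → ℝ) :
    ∫ t in Ioi (0 : ℝ), gaussMoment j t y * t ^ (((d : ℝ) - 1) / 2) = rieszKernel d y j := by
  unfold gaussMoment rieszKernel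
  by_cases h : y = 0
  · simp [h]
  have hp := eucNorm_pos h
  have key := Real.integral_rpow_mul_exp_neg_mul_Ioi (a := ((d : ℝ) + 1) / 2)
    (r := Real.pi * eucNorm y ^ 2) (by positivity) (by positivity)
  have e : ∀ t : ℝ, y j * Real.exp (-(Real.pi * t * eucNorm y ^ 2)) * t ^ (((d : ℝ) - 1) / 2)
      = y j * (t ^ (((d : ℝ) + 1) / 2 - 1) * Real.exp (-(Real.pi * eucNorm y ^ 2 * t))) := by
    intro t
    rw [show ((d : ℝ) + 1) / 2 - 1 = ((d : ℝ) - 1) / 2 by ring,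
      show Real.pi * t * eucNorm y ^ 2 = Real.pi * eucNorm y ^ 2 * t by ring]
    ring
  simp_rw [e]
  rw [integral_const_mul, key]
  simp only [h, if_false, rieszConst]
  have e2 : (1 / (Real.pi * eucNorm y ^ 2)) ^ (((d : ℝ) + 1) / 2)
      = 1 / (Real.pi ^ (((d : ℝ) + 1) / 2) * eucNorm y ^ (d + 1)) := by
    rw [Real.div_rpow (by positivity) (by positivity), Real.one_rpow,
      Real.mul_rpow (by positivity) (by positivity), ← Real.rpow_natCast (eucNorm y) 2,
      ← Real.rpow_mul hp.le, ← Real.rpow_natCast (eucNorm y) (d + 1)]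
    congr 3
    push_cast; ring
  rw [e2]
  field_simp

lemma integrableOn_gaussMoment_mul_rpow (j : Fin d) (y : Fin d → ℝ) :
    IntegrableOn (fun t => gaussMoment j t y * t ^ (((d : ℝ) - 1) / 2)) (Ioi (0 : ℝ)) := by
  by_cases h : y j = 0
  · simp [gaussMoment, h]
  have h0 : y ≠ 0 := fun h' => h (by simp [h'])
  refine Integrable.of_integral_ne_zero ?_
  rw [integral_gaussMoment_mul_rpow, rieszKernel, if_neg h0]
  have := rieszConst_pos (d := d)
  have := eucNorm_pos h0
  positivity

lemma integral_abs_gaussMoment_mul_rpow (j : Fin d) (y : Fin d → ℝ) :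
    ∫ t in Ioi (0 : ℝ), |gaussMoment j t y * t ^ (((d : ℝ) - 1) / 2)| = |rieszKernel d y j| := by
  rw [← integral_gaussMoment_mul_rpow]
  rcases le_total 0 (y j) with h | h
  · have hnn : ∀ t ∈ Ioi (0 : ℝ), 0 ≤ gaussMoment j t y * t ^ (((d : ℝ) - 1) / 2) := by
      intro t ht
      have : (0 : ℝ) < t := ht
      unfold gaussMoment; positivity
    rw [abs_of_nonneg (setIntegral_nonneg measurableSet_Ioi hnn)]
    exact setIntegral_congr_fun measurableSet_Ioi fun t ht => abs_of_nonneg (hnn t ht)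
  · have hnp : ∀ t ∈ Ioi (0 : ℝ), gaussMoment j t y * t ^ (((d : ℝ) - 1) / 2) ≤ 0 := by
      intro t ht
      have : (0 : ℝ) < t := ht
      unfold gaussMoment
      exact mul_nonpos_of_nonpos_of_nonneg
        (mul_nonpos_of_nonpos_of_nonneg h (Real.exp_pos _).le) (by positivity)
    rw [abs_of_nonpos (setIntegral_nonpos measurableSet_Ioi hnp), ← integral_neg]
    exact setIntegral_congr_fun measurableSet_Ioi fun t ht => abs_of_nonpos (hnp t ht)

end RieszKernel

section TimeIntegral

lemma integral_rpow_mul_exp_neg_div {r : ℝ} (hr : 0 < r) :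
    ∫ t in Ioi (0 : ℝ), t ^ (-(3 : ℝ) / 2) * Real.exp (-(Real.pi * r ^ 2 / t)) = 1 / r := by
  have key := Real.integral_rpow_mul_exp_neg_mul_Ioi (a := 1 / 2)
    (r := Real.pi * r ^ 2) (by positivity) (by positivity)
  rw [← integral_comp_rpow_Ioi _ (show (-1 : ℝ) ≠ 0 by norm_num)] at key
  have e : ∀ t ∈ Ioi (0 : ℝ), (|(-1 : ℝ)| * t ^ ((-1 : ℝ) - 1)) •
      ((t ^ (-1 : ℝ)) ^ ((1 : ℝ) / 2 - 1) * Real.exp (-(Real.pi * r ^ 2 * t ^ (-1 : ℝ)))) =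
      t ^ (-(3 : ℝ) / 2) * Real.exp (-(Real.pi * r ^ 2 / t)) := by
    intro t ht
    have ht : 0 < t := ht
    rw [← Real.rpow_mul ht.le, smul_eq_mul, ← mul_assoc, abs_neg, abs_one, one_mul,
      ← Real.rpow_add ht, Real.rpow_neg_one, div_eq_mul_inv (Real.pi * r ^ 2)]
    norm_num
  rw [setIntegral_congr_fun measurableSet_Ioi e] at key
  rw [key, Real.Gamma_one_half_eq, ← Real.sqrt_eq_rpow, Real.sqrt_div zero_le_one,
    Real.sqrt_mul Real.pi_pos.le, Real.sqrt_sq hr.le]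
  have : 0 < √Real.pi := Real.sqrt_pos.2 Real.pi_pos
  field_simp
  simp

lemma integrableOn_rpow_mul_exp_neg_div {r : ℝ} (hr : 0 < r) :
    IntegrableOn (fun t => t ^ (-(3 : ℝ) / 2) * Real.exp (-(Real.pi * r ^ 2 / t)))
      (Ioi (0 : ℝ)) :=
  Integrable.of_integral_ne_zero (by rw [integral_rpow_mul_exp_neg_div hr]; positivity)

end TimeIntegral

section GaussianFourier

/-- The one-dimensional function `v ↦ e^{-2πi u v} e^{-πt v²}`. -/
def gaussWave (t u v : ℝ) : ℂ :=
  Complex.exp (((-(2 * Real.pi * u * v) : ℝ) : ℂ) * Complex.I + ((-(Real.pi * t * v ^ 2) : ℝ) : ℂ))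

lemma norm_gaussWave (t u v : ℝ) : ‖gaussWave t u v‖ = Real.exp (-(Real.pi * t) * v ^ 2) := by
  rw [gaussWave, Complex.norm_exp]
  simp only [Complex.add_re, Complex.re_ofReal_mul, Complex.I_re, Complex.ofReal_re]
  ring_nf

lemma continuous_gaussWave (t u : ℝ) : Continuous (gaussWave t u) := by
  unfold gaussWave; fun_prop

lemma integrable_gaussWave {t : ℝ} (ht : 0 < t) (u : ℝ) : Integrable (gaussWave t u) := by
  refine (integrable_norm_iff (continuous_gaussWave t u).aestronglyMeasurable).1 ?_
  simp_rw [norm_gaussWave]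
  exact integrable_exp_neg_mul_sq (by positivity)

lemma integrable_mul_gaussWave {t : ℝ} (ht : 0 < t) (u : ℝ) :
    Integrable fun v : ℝ => (v : ℂ) * gaussWave t u v := by
  have hc := continuous_gaussWave t u
  refine (integrable_norm_iff (by fun_prop : Continuous _).aestronglyMeasurable).1 ?_
  simp_rw [norm_mul, norm_gaussWave, Complex.norm_real]
  refine ((integrable_mul_exp_neg_mul_sq (b := Real.pi * t) (by positivity)).norm).congr ?_
  filter_upwards with v
  rw [norm_mul, Real.norm_of_nonneg (Real.exp_pos _).le]

lemma integral_gaussWave {t : ℝ} (ht : 0 < t) (u : ℝ) :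
    ∫ v, gaussWave t u v = ((t ^ (-(1 : ℝ) / 2) * Real.exp (-(Real.pi * u ^ 2 / t)) : ℝ) : ℂ) := by
  have key := fourierIntegral_gaussian (b := ((Real.pi * t : ℝ) : ℂ))
    (by rw [Complex.ofReal_re]; positivity) ((-(2 * Real.pi * u) : ℝ) : ℂ)
  have e : ∀ v : ℝ, Complex.exp (Complex.I * ((-(2 * Real.pi * u) : ℝ) : ℂ) * v) *
      Complex.exp (-((Real.pi * t : ℝ) : ℂ) * v ^ 2) = gaussWave t u v := by
    intro v
    rw [gaussWave, ← Complex.exp_add]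
    push_cast
    ring_nf
  simp_rw [e] at key
  rw [key]
  have hpi := Real.pi_pos
  have e1 : ((Real.pi : ℂ) / ((Real.pi * t : ℝ) : ℂ)) ^ (1 / 2 : ℂ)
      = ((t ^ (-(1 : ℝ) / 2) : ℝ) : ℂ) := by
    rw [show (Real.pi : ℂ) / ((Real.pi * t : ℝ) : ℂ) = ((t⁻¹ : ℝ) : ℂ) by
      push_cast; field_simp,
      show (1 / 2 : ℂ) = ((1 / 2 : ℝ) : ℂ) by push_cast; rfl,
      ← Complex.ofReal_cpow (by positivity), Real.inv_rpow ht.le, ← Real.rpow_neg ht.le]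
    norm_num
  rw [e1, Complex.ofReal_mul (t ^ _), Complex.ofReal_exp]
  congr 2
  push_cast
  have : (t : ℂ) ≠ 0 := by exact_mod_cast ht.ne'
  have : (Real.pi : ℂ) ≠ 0 := by exact_mod_cast hpi.ne'
  field_simp
  ring

lemma integral_mul_gaussWave {t : ℝ} (ht : 0 < t) (u : ℝ) :
    ∫ v : ℝ, (v : ℂ) * gaussWave t u v = -Complex.I * u / t * ∫ v, gaussWave t u v := by
  have hderiv : ∀ v : ℝ, HasDerivAt (gaussWave t u)
      (-(2 * Real.pi * u * Complex.I) * gaussWave t u v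
        + -(2 * Real.pi * t) * ((v : ℂ) * gaussWave t u v)) v := by
    intro v
    have h : HasDerivAt (fun v : ℝ => -(2 * Real.pi * u * (v : ℂ)) * Complex.I
        + -(Real.pi * t * (v : ℂ) ^ 2))
        (-(2 * Real.pi * u * 1) * Complex.I + -(Real.pi * t * (2 * (v : ℂ)))) v := by
      have h1 : HasDerivAt (fun v : ℝ => (v : ℂ)) 1 v := Complex.ofRealCLM.hasDerivAt
      have h2 : HasDerivAt (fun v : ℝ => (v : ℂ) ^ 2) (2 * (v : ℂ)) v := by
        simpa using h1.fun_pow 2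
      exact (((h1.const_mul (2 * (Real.pi : ℂ) * u)).neg).mul_const Complex.I).add
        ((h2.const_mul ((Real.pi : ℂ) * t)).neg)
    have h' := h.cexp
    have e : gaussWave t u = fun v : ℝ => Complex.exp (-(2 * Real.pi * u * (v : ℂ)) * Complex.I
        + -(Real.pi * t * (v : ℂ) ^ 2)) := by
      ext v; rw [gaussWave]; push_cast; rfl
    rw [e]
    convert h' using 1
    ring
  have i1 := (integrable_gaussWave ht u).const_mul (-(2 * Real.pi * u * Complex.I))
  have i2 := (integrable_mul_gaussWave ht u).const_mul (-(2 * Real.pi * t) : ℂ)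
  have key := integral_eq_zero_of_hasDerivAt_of_integrable hderiv (i1.add i2)
    (integrable_gaussWave ht u)
  rw [integral_add i1 i2, integral_const_mul, integral_const_mul] at key
  have h1 : (t : ℂ) ≠ 0 := by exact_mod_cast ht.ne'
  have h3 : (2 * Real.pi : ℂ) * (t * ∫ v : ℝ, (v : ℂ) * gaussWave t u v)
      = (2 * Real.pi : ℂ) * (-Complex.I * u * ∫ v, gaussWave t u v) := by
    linear_combination -key
  have h4 := mul_left_cancel₀ (by simp) h3
  rw [div_mul_eq_mul_div, eq_div_iff h1, ← h4]
  ring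

variable {d : ℕ}

lemma expChar_neg_mul_gaussMoment (j : Fin d) (t : ℝ) (ξ y : Fin d → ℝ) :
    expChar ξ (-y) * (gaussMoment j t y : ℂ)
      = ∏ i, (if i = j then (y i : ℂ) else 1) * gaussWave t (ξ i) (y i) := by
  rw [Finset.prod_mul_distrib, Finset.prod_ite_eq' Finset.univ j (fun i => (y i : ℂ))]
  simp only [Finset.mem_univ, if_true, gaussWave, ← Complex.exp_sum]
  rw [gaussMoment, Complex.ofReal_mul, Complex.ofReal_exp, mul_left_comm, expChar,
    ← Complex.exp_add, eucNorm_sq, dotP]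
  congr 2
  rw [Finset.sum_add_distrib, ← Finset.sum_mul, ← Complex.ofReal_sum, ← Complex.ofReal_sum]
  congr 3
  · rw [Finset.mul_sum]
    refine Finset.sum_congr rfl fun i _ => ?_
    rw [Pi.neg_apply]; ring
  · rw [Finset.mul_sum, ← Finset.sum_neg_distrib]

lemma continuous_gaussMoment (j : Fin d) :
    Continuous fun p : ℝ × (Fin d → ℝ) => gaussMoment j p.1 p.2 := by
  unfold gaussMoment; fun_prop

lemma gaussMoment_neg (j : Fin d) (t : ℝ) (y : Fin d → ℝ) :
    gaussMoment j t (-y) = -gaussMoment j t y := by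
  simp [gaussMoment, eucNorm_neg]

lemma integrable_gaussMoment (j : Fin d) {t : ℝ} (ht : 0 < t) : Integrable (gaussMoment j t) := by
  have h : Integrable fun y : Fin d → ℝ =>
      ∏ i, (if i = j then (y i : ℂ) else 1) * gaussWave t ((0 : Fin d → ℝ) i) (y i) := by
    refine Integrable.fintype_prod (f := fun i (v : ℝ) =>
      (if i = j then (v : ℂ) else 1) * gaussWave t ((0 : Fin d → ℝ) i) v) fun i => ?_
    by_cases h : i = j
    · simpa only [h, if_true] using integrable_mul_gaussWave ht _
    · simpa only [h, if_false, one_mul] using integrable_gaussWave ht _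
  simp_rw [← expChar_neg_mul_gaussMoment] at h
  have e : ∀ y : Fin d → ℝ, expChar 0 (-y) = 1 := fun y => by simp [expChar, dotP]
  simp_rw [e, one_mul] at h
  exact h.re

lemma integral_expChar_mul_gaussMoment (j : Fin d) {t : ℝ} (ht : 0 < t) (ξ : Fin d → ℝ) :
    (∫ y, expChar ξ (-y) * (gaussMoment j t y : ℂ)) * ((t ^ (((d : ℝ) - 1) / 2) : ℝ) : ℂ)
      = -Complex.I * ξ j *
        ((t ^ (-(3 : ℝ) / 2) * Real.exp (-(Real.pi * eucNorm ξ ^ 2 / t)) : ℝ) : ℂ) := by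
  simp_rw [expChar_neg_mul_gaussMoment]
  rw [integral_fintype_prod_volume_eq_prod (fun i (v : ℝ) =>
      (if i = j then (v : ℂ) else 1) * gaussWave t (ξ i) v)]
  have e : ∀ i, ∫ v : ℝ, (if i = j then (v : ℂ) else 1) * gaussWave t (ξ i) v
      = (if i = j then -Complex.I * ξ i / t else 1) *
        ((t ^ (-(1 : ℝ) / 2) * Real.exp (-(Real.pi * ξ i ^ 2 / t)) : ℝ) : ℂ) := by
    intro i
    by_cases h : i = j
    · simp only [h, if_true]
      rw [integral_mul_gaussWave ht, integral_gaussWave ht]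
    · simp only [h, if_false, one_mul]
      rw [integral_gaussWave ht]
  simp_rw [e]
  rw [Finset.prod_mul_distrib, Finset.prod_ite_eq' Finset.univ j
    (fun i => -Complex.I * (ξ i : ℂ) / t)]
  simp only [Finset.mem_univ, if_true]
  rw [← Complex.ofReal_prod, Finset.prod_mul_distrib, ← Real.exp_sum, Finset.prod_const,
    Finset.card_univ, Fintype.card_fin, Finset.sum_neg_distrib, ← Finset.sum_div,
    ← Finset.mul_sum, ← eucNorm_sq]
  have e3 : t ^ (-(3 : ℝ) / 2) = t⁻¹ * (t ^ (-(1 : ℝ) / 2)) ^ d * t ^ (((d : ℝ) - 1) / 2) := by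
    rw [← Real.rpow_natCast, ← Real.rpow_mul ht.le, ← Real.rpow_neg_one, ← Real.rpow_add ht,
      ← Real.rpow_add ht]
    congr 1
    ring
  rw [e3]
  push_cast
  ring

end GaussianFourier

section SymmetricDifference

variable {d : ℕ}

lemma integrable_indicator_eucNorm_div_pow (hd : d ≠ 0) :
    Integrable fun y : Fin d → ℝ =>
      (Iic (1 : ℝ)).indicator (fun r => r / r ^ d) (eucNorm y) := by
  have : Nonempty (Fin d) := ⟨⟨0, Nat.pos_of_ne_zero hd⟩⟩
  simp_rw [eucNorm_eq_norm]
  refine ((PiLp.volume_preserving_toLp (Fin d)).integrable_comp_emb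
    (MeasurableEquiv.toLp 2 _).measurableEmbedding (g := fun y : EuclideanSpace ℝ (Fin d) =>
      (Iic (1 : ℝ)).indicator (fun r => r / r ^ d) ‖y‖)).2 ?_
  rw [integrable_fun_norm_addHaar volume (f := (Iic (1 : ℝ)).indicator fun r => r / r ^ d)]
  have h1 : IntegrableOn ((Iic (1 : ℝ)).indicator fun _ => (1 : ℝ)) (Ioi (0 : ℝ)) := by
    rw [IntegrableOn, integrable_indicator_iff measurableSet_Iic, IntegrableOn,
      Measure.restrict_restrict measurableSet_Iic, Iic_inter_Ioi]
    exact integrable_const _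
  refine h1.congr_fun (fun r hr => ?_) measurableSet_Ioi
  have hr : 0 < r := hr
  simp only [finrank_euclideanSpace, Fintype.card_fin, indicator_apply, smul_eq_mul]
  split_ifs
  · obtain ⟨n, rfl⟩ := Nat.exists_eq_succ_of_ne_zero hd
    rw [Nat.succ_eq_add_one, Nat.add_sub_cancel, pow_succ]
    field_simp
  · simp

variable {H : (Fin d → ℝ) → ℂ} {L : ℝ}

lemma continuous_of_norm_sub_le (hL : ∀ x y, ‖H x - H y‖ ≤ L * ‖x - y‖) : Continuous H := by
  refine (LipschitzWith.of_dist_le_mul (K := L.toNNReal) fun x y => ?_).continuous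
  rw [dist_eq_norm, dist_eq_norm]
  exact (hL x y).trans (mul_le_mul_of_nonneg_right (Real.le_coe_toNNReal L) (norm_nonneg _))

lemma norm_symmDiff_mul_rieszKernel_le (j : Fin d) (hL0 : 0 ≤ L)
    (hL : ∀ x y, ‖H x - H y‖ ≤ L * ‖x - y‖) (x y : Fin d → ℝ) :
    ‖(H (x - y) - H (x + y)) * (rieszKernel d y j : ℂ)‖ ≤
      2 * L * rieszConst d * (Iic (1 : ℝ)).indicator (fun r => r / r ^ d) (eucNorm y)
        + rieszConst d * (‖H (x - y)‖ + ‖H (x + y)‖) := by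
  have hc := rieszConst_pos (d := d)
  have hn := eucNorm_nonneg y
  rw [norm_mul, Complex.norm_real, Real.norm_eq_abs]
  by_cases h : eucNorm y ≤ 1
  · have h1 : ‖H (x - y) - H (x + y)‖ ≤ 2 * L * eucNorm y := by
      refine (hL _ _).trans ?_
      have : ‖x - y - (x + y)‖ ≤ 2 * eucNorm y := by
        rw [show x - y - (x + y) = -((2 : ℝ) • y) by rw [two_smul]; abel, norm_neg, norm_smul]
        simpa using norm_le_eucNorm y
      nlinarith
    rw [indicator_of_mem (by exact h)]
    calc _ ≤ 2 * L * eucNorm y * (rieszConst d / eucNorm y ^ d) :=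
          mul_le_mul h1 (abs_rieszKernel_le y j) (abs_nonneg _) (by positivity)
      _ = 2 * L * rieszConst d * (eucNorm y / eucNorm y ^ d) := by ring
      _ ≤ _ := le_add_of_nonneg_right (by positivity)
  · rw [indicator_of_notMem (by exact h), mul_zero, zero_add, mul_comm]
    have := abs_rieszKernel_le_of_lt one_pos (not_le.1 h) j
    rw [one_pow, div_one] at this
    exact mul_le_mul this (norm_sub_le _ _) (norm_nonneg _) hc.le

lemma integrable_symmDiff_mul_rieszKernel (j : Fin d) (hL0 : 0 ≤ L)
    (hL : ∀ x y, ‖H x - H y‖ ≤ L * ‖x - y‖) (hH : Integrable H) (x : Fin d → ℝ) :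
    Integrable fun y => (H (x - y) - H (x + y)) * (rieszKernel d y j : ℂ) := by
  have hHc := continuous_of_norm_sub_le hL
  have hd : d ≠ 0 := by rintro rfl; exact j.elim0
  refine Integrable.mono' (((integrable_indicator_eucNorm_div_pow hd).const_mul
    (2 * L * rieszConst d)).add ((((hH.comp_sub_left x).norm).add
      ((hH.comp_add_left x).norm)).const_mul (rieszConst d)))
    ?_ (Eventually.of_forall fun y => norm_symmDiff_mul_rieszKernel_le j hL0 hL x y)
  exact ((by fun_prop : Continuous fun y => H (x - y) - H (x + y)).measurable.mul
    (measurable_rieszKernel j).complex_ofReal).aestronglyMeasurable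

lemma exists_integral_norm_symmDiff_mul_rieszKernel_le (j : Fin d) (hL0 : 0 ≤ L)
    (hL : ∀ x y, ‖H x - H y‖ ≤ L * ‖x - y‖) (hH : Integrable H) :
    ∃ B, ∀ x, ∫ y, ‖(H (x - y) - H (x + y)) * (rieszKernel d y j : ℂ)‖ ≤ B := by
  have hd : d ≠ 0 := by rintro rfl; exact j.elim0
  have i1 := (integrable_indicator_eucNorm_div_pow hd).const_mul (2 * L * rieszConst d)
  refine ⟨(∫ y : Fin d → ℝ, 2 * L * rieszConst d *
      (Iic (1 : ℝ)).indicator (fun r => r / r ^ d) (eucNorm y))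
    + rieszConst d * ((∫ y, ‖H y‖) + ∫ y, ‖H y‖), fun x => ?_⟩
  have i2 := (hH.comp_sub_left x).norm
  have i3 := (hH.comp_add_left x).norm
  have i4 : Integrable fun y => rieszConst d * (‖H (x - y)‖ + ‖H (x + y)‖) :=
    (i2.add i3).const_mul (rieszConst d)
  refine (integral_mono (integrable_symmDiff_mul_rieszKernel j hL0 hL hH x).norm
    (i1.add i4) (norm_symmDiff_mul_rieszKernel_le j hL0 hL x)).trans_eq ?_
  simp only [Pi.add_apply]
  rw [integral_add i1 i4, integral_const_mul (rieszConst d), integral_add i2 i3,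
    integral_sub_left_eq_self (fun y => ‖H y‖), integral_add_left_eq_self (fun y => ‖H y‖)]

/-- The `j`-th component of the truncated Riesz transform. -/
def truncRieszCoord (H : (Fin d → ℝ) → ℂ) (j : Fin d) (x : Fin d → ℝ) (ε : ℝ) : ℂ :=
  ∫ y in {y : Fin d → ℝ | ε < eucNorm y}, H (x - y) * (rieszKernel d y j : ℂ)

lemma measurableSet_lt_eucNorm (ε : ℝ) : MeasurableSet {y : Fin d → ℝ | ε < eucNorm y} :=
  measurableSet_lt measurable_const continuous_eucNorm.measurable

lemma integrableOn_mul_rieszKernel (hH : Integrable H) (j : Fin d) {ε : ℝ} (hε : 0 < ε) :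
    IntegrableOn (fun y => H y * (rieszKernel d y j : ℂ)) {y : Fin d → ℝ | ε < eucNorm y} := by
  refine Integrable.mul_bdd (c := rieszConst d / ε ^ d) hH.integrableOn
    (measurable_rieszKernel j).complex_ofReal.aestronglyMeasurable ?_
  refine (ae_restrict_iff' (measurableSet_lt_eucNorm ε)).2 (Eventually.of_forall fun y hy => ?_)
  rw [Complex.norm_real]
  exact abs_rieszKernel_le_of_lt hε hy j

lemma truncRieszCoord_eq_symmDiff (hH : Integrable H) (j : Fin d) (x : Fin d → ℝ) {ε : ℝ}
    (hε : 0 < ε) : truncRieszCoord H j x ε = (1 / 2 : ℂ) *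
      ∫ y in {y : Fin d → ℝ | ε < eucNorm y},
        (H (x - y) - H (x + y)) * (rieszKernel d y j : ℂ) := by
  have hm := measurableSet_lt_eucNorm (d := d) ε
  have i1 := integrableOn_mul_rieszKernel (hH.comp_sub_left x) j hε
  have i2 := integrableOn_mul_rieszKernel (hH.comp_add_left x) j hε
  have e : ∫ y in {y : Fin d → ℝ | ε < eucNorm y}, H (x + y) * (rieszKernel d y j : ℂ)
      = -truncRieszCoord H j x ε := by
    rw [truncRieszCoord, ← integral_indicator hm, ← integral_indicator hm, ← integral_neg,
      ← integral_neg_eq_self]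
    refine integral_congr_ae (Eventually.of_forall fun y => ?_)
    simp only [indicator_apply, mem_ofPred_eq, eucNorm_neg, rieszKernel_neg, ← sub_eq_add_neg]
    split_ifs <;> simp
  simp_rw [sub_mul]
  rw [integral_sub i1 i2, e, truncRieszCoord]
  ring

lemma exists_norm_truncRieszCoord_le (j : Fin d) (hL0 : 0 ≤ L)
    (hL : ∀ x y, ‖H x - H y‖ ≤ L * ‖x - y‖) (hH : Integrable H) :
    ∃ B, ∀ x, ∀ ε > 0, ‖truncRieszCoord H j x ε‖ ≤ B := by
  obtain ⟨B, hB⟩ := exists_integral_norm_symmDiff_mul_rieszKernel_le j hL0 hL hH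
  refine ⟨1 / 2 * B, fun x ε hε => ?_⟩
  rw [truncRieszCoord_eq_symmDiff hH j x hε, norm_mul]
  have h2 : ‖(1 / 2 : ℂ)‖ = 1 / 2 := by simp
  rw [h2]
  gcongr
  refine (norm_integral_le_integral_norm _).trans (le_trans ?_ (hB x))
  exact setIntegral_le_integral (integrable_symmDiff_mul_rieszKernel j hL0 hL hH x).norm
    (Eventually.of_forall fun y => norm_nonneg _)

lemma tendsto_truncRieszCoord_symmDiff (j : Fin d) (hL0 : 0 ≤ L)
    (hL : ∀ x y, ‖H x - H y‖ ≤ L * ‖x - y‖) (hH : Integrable H) (x : Fin d → ℝ) :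
    Tendsto (truncRieszCoord H j x) (𝓝[>] 0)
      (𝓝 ((1 / 2 : ℂ) * ∫ y, (H (x - y) - H (x + y)) * (rieszKernel d y j : ℂ))) := by
  have hi := integrable_symmDiff_mul_rieszKernel j hL0 hL hH x
  have key : Tendsto (fun ε : ℝ => (1 / 2 : ℂ) * ∫ y, {y : Fin d → ℝ | ε < eucNorm y}.indicator
      (fun y => (H (x - y) - H (x + y)) * (rieszKernel d y j : ℂ)) y) (𝓝[>] 0)
      (𝓝 ((1 / 2 : ℂ) * ∫ y, (H (x - y) - H (x + y)) * (rieszKernel d y j : ℂ))) := by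
    refine Tendsto.const_mul _ (tendsto_integral_filter_of_dominated_convergence
      (fun y => ‖(H (x - y) - H (x + y)) * (rieszKernel d y j : ℂ)‖) ?_ ?_ hi.norm ?_)
    · exact Eventually.of_forall fun ε =>
        hi.aestronglyMeasurable.indicator (measurableSet_lt_eucNorm ε)
    · exact Eventually.of_forall fun ε => Eventually.of_forall fun y =>
        norm_indicator_le_norm_self _ _
    · refine Eventually.of_forall fun y => ?_
      by_cases hy : y = 0
      · simp [hy, rieszKernel, indicator_apply]
      refine tendsto_const_nhds.congr' ?_
      filter_upwards [mem_nhdsWithin_of_mem_nhds (Iio_mem_nhds (eucNorm_pos hy))] with ε hε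
      rw [indicator_of_mem (by exact hε)]
  refine key.congr' ?_
  filter_upwards [self_mem_nhdsWithin] with ε hε
  rw [truncRieszCoord_eq_symmDiff hH j x hε, integral_indicator (measurableSet_lt_eucNorm ε)]

end SymmetricDifference

section RieszMultiplier

variable {d : ℕ} {H h : (Fin d → ℝ) → ℂ} {L : ℝ}

lemma norm_rieszSymbol_le (j : Fin d) (ξ : Fin d → ℝ) : ‖rieszSymbol j ξ‖ ≤ 1 := by
  rw [rieszSymbol, norm_mul, norm_neg, Complex.norm_I, one_mul, Complex.norm_real,
    Real.norm_eq_abs, abs_div, abs_of_nonneg (eucNorm_nonneg ξ)]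
  exact div_le_one_of_le₀ (abs_apply_le_eucNorm ξ j) (eucNorm_nonneg ξ)

lemma measurable_rieszSymbol (j : Fin d) : Measurable (rieszSymbol j) := by
  have := (continuous_eucNorm (d := d)).measurable
  unfold rieszSymbol; fun_prop

lemma integral_symmDiff_mul_rieszKernel_eq_integral_Ioi (j : Fin d) (hL0 : 0 ≤ L)
    (hL : ∀ x y, ‖H x - H y‖ ≤ L * ‖x - y‖) (hH : Integrable H) (x : Fin d → ℝ) :
    ∫ y, (H (x - y) - H (x + y)) * (rieszKernel d y j : ℂ) =
      ∫ t in Ioi (0 : ℝ), ∫ y, (H (x - y) - H (x + y)) *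
        ((gaussMoment j t y * t ^ (((d : ℝ) - 1) / 2) : ℝ) : ℂ) := by
  have hHc := continuous_of_norm_sub_le hL
  have hmeas : Measurable fun p : (Fin d → ℝ) × ℝ => (H (x - p.1) - H (x + p.1)) *
      ((gaussMoment j p.2 p.1 * p.2 ^ (((d : ℝ) - 1) / 2) : ℝ) : ℂ) := by
    have h1 : Measurable fun p : (Fin d → ℝ) × ℝ => H (x - p.1) - H (x + p.1) :=
      (by fun_prop : Continuous _).measurable
    have h2 : Measurable fun p : (Fin d → ℝ) × ℝ => gaussMoment j p.2 p.1 :=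
      ((continuous_gaussMoment j).comp continuous_swap).measurable
    exact h1.mul (h2.mul (measurable_snd.pow_const _)).complex_ofReal
  rw [← integral_integral_swap]
  · refine integral_congr_ae (Eventually.of_forall fun y => ?_)
    simp only
    rw [integral_const_mul, integral_complex_ofReal, integral_gaussMoment_mul_rpow]
  · refine (integrable_prod_iff hmeas.aestronglyMeasurable).2
      ⟨Eventually.of_forall fun y => ?_, ?_⟩
    · exact ((integrableOn_gaussMoment_mul_rpow j y).ofReal (𝕜 := ℂ)).const_mul
        (H (x - y) - H (x + y))
    · refine (integrable_symmDiff_mul_rieszKernel j hL0 hL hH x).norm.congr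
        (Eventually.of_forall fun y => ?_)
      simp only [norm_mul, Complex.norm_real]
      rw [integral_const_mul]
      simp_rw [← norm_mul, Real.norm_eq_abs]
      rw [integral_abs_gaussMoment_mul_rpow]

lemma integral_comp_sub_mul_gaussMoment (hh : Integrable h)
    (hHh : ∀ x, H x = ∫ ξ, expChar ξ x * h ξ) (j : Fin d) {t : ℝ} (ht : 0 < t)
    (x : Fin d → ℝ) :
    ∫ y, H (x - y) * (gaussMoment j t y : ℂ) =
      ∫ ξ, expChar ξ x * h ξ * ∫ y, expChar ξ (-y) * (gaussMoment j t y : ℂ) := by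
  have hg : Integrable fun y => (gaussMoment j t y : ℂ) := (integrable_gaussMoment j ht).ofReal
  simp_rw [← integral_const_mul]
  rw [integral_integral_swap]
  · refine integral_congr_ae (Eventually.of_forall fun y => ?_)
    simp only
    rw [hHh, ← integral_mul_const]
    refine integral_congr_ae (Eventually.of_forall fun ξ => ?_)
    simp only [expChar_sub]
    ring
  · have hc : Continuous fun p : (Fin d → ℝ) × (Fin d → ℝ) => expChar p.1 (x - p.2) := by
      fun_prop
    refine ((hh.mul_prod hg).bdd_mul (c := 1) hc.aestronglyMeasurable
      (Eventually.of_forall fun p => by simp)).congr (Eventually.of_forall fun p => ?_)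
    simp only [Function.uncurry, expChar_sub]
    ring

lemma integral_symmDiff_mul_gaussMoment (hL : ∀ x y, ‖H x - H y‖ ≤ L * ‖x - y‖)
    (hHb : ∃ C, ∀ x, ‖H x‖ ≤ C) (j : Fin d) {t : ℝ} (ht : 0 < t) (x : Fin d → ℝ) :
    ∫ y, (H (x - y) - H (x + y)) * (gaussMoment j t y : ℂ) =
      2 * ∫ y, H (x - y) * (gaussMoment j t y : ℂ) := by
  have hHc := continuous_of_norm_sub_le hL
  obtain ⟨C, hC⟩ := hHb
  have hg : Integrable fun y => (gaussMoment j t y : ℂ) := (integrable_gaussMoment j ht).ofReal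
  have i1 : Integrable fun y => H (x - y) * (gaussMoment j t y : ℂ) :=
    hg.bdd_mul (c := C) (by fun_prop : Continuous _).aestronglyMeasurable
      (Eventually.of_forall fun y => hC _)
  have i2 : Integrable fun y => H (x + y) * (gaussMoment j t y : ℂ) :=
    hg.bdd_mul (c := C) (by fun_prop : Continuous _).aestronglyMeasurable
      (Eventually.of_forall fun y => hC _)
  simp_rw [sub_mul]
  rw [integral_sub i1 i2, ← integral_neg_eq_self fun y => H (x + y) * (gaussMoment j t y : ℂ)]
  simp only [gaussMoment_neg, ← sub_eq_add_neg, Complex.ofReal_neg, mul_neg]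
  rw [integral_neg]
  ring

lemma integral_Ioi_mul_rpow_mul_exp (hh : Integrable h) (j : Fin d) (x : Fin d → ℝ) :
    ∫ t in Ioi (0 : ℝ), ∫ ξ, expChar ξ x * h ξ * (-Complex.I * ξ j *
        ((t ^ (-(3 : ℝ) / 2) * Real.exp (-(Real.pi * eucNorm ξ ^ 2 / t)) : ℝ) : ℂ)) =
      ∫ ξ, expChar ξ x * (rieszSymbol j ξ * h ξ) := by
  have hmeas : AEStronglyMeasurable (fun p : (Fin d → ℝ) × ℝ => expChar p.1 x * h p.1 *
      (-Complex.I * p.1 j * ((p.2 ^ (-(3 : ℝ) / 2) *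
        Real.exp (-(Real.pi * eucNorm p.1 ^ 2 / p.2)) : ℝ) : ℂ)))
      (volume.prod (volume.restrict (Ioi 0))) := by
    have h1 : Continuous fun p : (Fin d → ℝ) × ℝ => expChar p.1 x := by fun_prop
    have h2 : Measurable fun p : (Fin d → ℝ) × ℝ => (-Complex.I * p.1 j *
        ((p.2 ^ (-(3 : ℝ) / 2) * Real.exp (-(Real.pi * eucNorm p.1 ^ 2 / p.2)) : ℝ) : ℂ)) := by
      have := (continuous_eucNorm (d := d)).measurable
      fun_prop
    exact (h1.aestronglyMeasurable.mul hh.aestronglyMeasurable.comp_fst).mul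
      h2.aestronglyMeasurable
  have hi : ∀ ξ : Fin d → ℝ, IntegrableOn (fun t : ℝ => expChar ξ x * h ξ *
      (-Complex.I * ξ j * ((t ^ (-(3 : ℝ) / 2) *
        Real.exp (-(Real.pi * eucNorm ξ ^ 2 / t)) : ℝ) : ℂ))) (Ioi 0) := by
    intro ξ
    by_cases hξ : ξ = 0
    · simp [hξ]
    · exact ((integrableOn_rpow_mul_exp_neg_div (eucNorm_pos hξ)).ofReal.const_mul _).const_mul _
  rw [← integral_integral_swap]
  · refine integral_congr_ae (Eventually.of_forall fun ξ => ?_)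
    simp only
    rw [integral_const_mul, integral_const_mul, integral_complex_ofReal]
    by_cases hξ : ξ = 0
    · simp [hξ, rieszSymbol]
    rw [integral_rpow_mul_exp_neg_div (eucNorm_pos hξ), rieszSymbol]
    push_cast
    ring
  · refine (integrable_prod_iff hmeas).2 ⟨Eventually.of_forall hi, ?_⟩
    have hb : Integrable fun ξ => ‖rieszSymbol j ξ‖ * ‖h ξ‖ :=
      hh.norm.bdd_mul (c := 1) (measurable_rieszSymbol j).norm.aestronglyMeasurable
        (Eventually.of_forall fun ξ => by simpa using norm_rieszSymbol_le j ξ)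
    refine hb.congr (Eventually.of_forall fun ξ => ?_)
    simp only [norm_mul, norm_expChar, one_mul, norm_neg, Complex.norm_I,
      Complex.norm_real]
    by_cases hξ : ξ = 0
    · simp [hξ, rieszSymbol]
    rw [integral_const_mul, integral_const_mul]
    have e : ∀ t ∈ Ioi (0 : ℝ), ‖t ^ (-(3 : ℝ) / 2)‖ *
        ‖Real.exp (-(Real.pi * eucNorm ξ ^ 2 / t))‖ =
        t ^ (-(3 : ℝ) / 2) * Real.exp (-(Real.pi * eucNorm ξ ^ 2 / t)) := by
      intro t ht
      rw [Real.norm_of_nonneg (Real.rpow_nonneg (le_of_lt ht) _),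
        Real.norm_of_nonneg (Real.exp_pos _).le]
    rw [setIntegral_congr_fun measurableSet_Ioi e,
      integral_rpow_mul_exp_neg_div (eucNorm_pos hξ), rieszSymbol, norm_mul, norm_neg,
      Complex.norm_I, one_mul, Complex.norm_real, norm_div,
      Real.norm_of_nonneg (eucNorm_nonneg ξ)]
    ring

/-- On the Fourier side the Riesz transform of an integrable Lipschitz function is the multiplier
`-i ξ_j / |ξ|`. -/
lemma tendsto_truncRieszCoord (j : Fin d) (hL0 : 0 ≤ L)
    (hL : ∀ x y, ‖H x - H y‖ ≤ L * ‖x - y‖) (hH : Integrable H) (hh : Integrable h)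
    (hHh : ∀ x, H x = ∫ ξ, expChar ξ x * h ξ) (x : Fin d → ℝ) :
    Tendsto (truncRieszCoord H j x) (𝓝[>] 0)
      (𝓝 (∫ ξ, expChar ξ x * (rieszSymbol j ξ * h ξ))) := by
  have hHb : ∃ C, ∀ x, ‖H x‖ ≤ C := by
    refine ⟨∫ ξ, ‖h ξ‖, fun x => ?_⟩
    rw [hHh]
    refine (norm_integral_le_integral_norm _).trans_eq ?_
    simp
  have key : (1 / 2 : ℂ) * ∫ y, (H (x - y) - H (x + y)) * (rieszKernel d y j : ℂ) =
      ∫ ξ, expChar ξ x * (rieszSymbol j ξ * h ξ) := by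
    rw [integral_symmDiff_mul_rieszKernel_eq_integral_Ioi j hL0 hL hH x,
      ← integral_Ioi_mul_rpow_mul_exp hh j x, ← integral_const_mul]
    refine setIntegral_congr_fun measurableSet_Ioi fun t ht => ?_
    have ht : 0 < t := ht
    simp only [Complex.ofReal_mul, ← mul_assoc]
    rw [integral_mul_const, integral_symmDiff_mul_gaussMoment hL hHb j ht,
      integral_comp_sub_mul_gaussMoment hh hHh j ht, ← mul_assoc, ← mul_assoc]
    rw [show (1 / 2 : ℂ) * 2 = 1 by norm_num, one_mul, ← integral_mul_const]
    refine integral_congr_ae (Eventually.of_forall fun ξ => ?_)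
    have := integral_expChar_mul_gaussMoment j ht ξ
    simp only
    rw [mul_assoc, this]
    push_cast
    ring
  rw [← key]
  exact tendsto_truncRieszCoord_symmDiff j hL0 hL hH x

end RieszMultiplier

section SchwartzInversion

open FourierTransform

variable {d : ℕ} {f : (Fin d → ℝ) → ℂ}

lemma integral_comp_toLp {E : Type*} [NormedAddCommGroup E] [NormedSpace ℝ E]
    (g : EuclideanSpace ℝ (Fin d) → E) :
    ∫ x : Fin d → ℝ, g (WithLp.toLp 2 x) = ∫ v, g v :=
  (PiLp.volume_preserving_toLp (Fin d)).integral_comp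
    (MeasurableEquiv.toLp 2 (Fin d → ℝ)).measurableEmbedding g

lemma dotP_eq_inner (ξ x : Fin d → ℝ) :
    dotP ξ x = inner ℝ (WithLp.toLp 2 ξ) (WithLp.toLp 2 x) := by
  simp [dotP, PiLp.inner_apply, mul_comm]

/-- The Fourier transform of a Schwartz function is that of the corresponding Schwartz map on
Euclidean space. -/
lemma IsSchwartz.exists_schwartzMap (hf : IsSchwartz f) :
    ∃ Φ : SchwartzMap (EuclideanSpace ℝ (Fin d)) ℂ,
      (∀ x, f x = Φ (WithLp.toLp 2 x)) ∧ ∀ ξ, ft f ξ = (𝓕 Φ) (WithLp.toLp 2 ξ) := by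
  obtain ⟨Φ, hΦ⟩ := hf
  let Ψ := SchwartzMap.compCLMOfContinuousLinearEquiv ℂ
    (PiLp.continuousLinearEquiv 2 ℝ (fun _ : Fin d => ℝ)) Φ
  have hΨ : ∀ x, f x = Ψ (WithLp.toLp 2 x) := fun x => by rw [hΦ]; rfl
  refine ⟨Ψ, hΨ, fun ξ => ?_⟩
  rw [SchwartzMap.fourier_coe, Real.fourier_eq', ← integral_comp_toLp, ft]
  refine integral_congr_ae (Eventually.of_forall fun x => ?_)
  simp only [hΨ, dotP_eq_inner, smul_eq_mul, real_inner_comm (WithLp.toLp 2 x)]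
  congr 3
  push_cast
  ring

lemma IsSchwartz.continuous (hf : IsSchwartz f) : Continuous f := by
  obtain ⟨Φ, hΦ⟩ := hf
  rw [funext hΦ]
  exact Φ.continuous

lemma IsSchwartz.integrable (hf : IsSchwartz f) : Integrable f := by
  obtain ⟨Φ, hΦ⟩ := hf
  rw [funext hΦ]
  exact Φ.integrable

lemma IsSchwartz.exists_norm_le (hf : IsSchwartz f) : ∃ C, ∀ x, ‖f x‖ ≤ C := by
  obtain ⟨Φ, hΦ⟩ := hf
  exact ⟨_, fun x => by rw [hΦ]; exact SchwartzMap.norm_le_seminorm ℝ Φ x⟩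

lemma IsSchwartz.exists_norm_sub_le (hf : IsSchwartz f) :
    ∃ L, 0 ≤ L ∧ ∀ x y, ‖f x - f y‖ ≤ L * ‖x - y‖ := by
  obtain ⟨Φ, hΦ⟩ := hf
  have hb : ∀ x, ‖fderiv ℝ Φ x‖ ≤ SchwartzMap.seminorm ℝ 0 0 (SchwartzMap.fderivCLM ℝ _ _ Φ) :=
    fun x => SchwartzMap.norm_le_seminorm ℝ (SchwartzMap.fderivCLM ℝ _ _ Φ) x
  refine ⟨_, (norm_nonneg _).trans (hb 0), fun x y => ?_⟩
  rw [hΦ, hΦ]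
  exact convex_univ.norm_image_sub_le_of_norm_fderiv_le
    (fun z _ => Φ.differentiableAt) (fun z _ => hb z) (mem_univ y) (mem_univ x)

lemma IsSchwartz.continuous_ft (hf : IsSchwartz f) : Continuous (ft f) := by
  obtain ⟨Φ, -, hΦ⟩ := hf.exists_schwartzMap
  rw [funext hΦ]
  exact (𝓕 Φ).continuous.comp (PiLp.continuous_toLp 2 _)

lemma IsSchwartz.integrable_ft (hf : IsSchwartz f) : Integrable (ft f) := by
  obtain ⟨Φ, -, hΦ⟩ := hf.exists_schwartzMap
  rw [funext hΦ]
  exact ((PiLp.volume_preserving_toLp (Fin d)).integrable_comp_emb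
    (MeasurableEquiv.toLp 2 (Fin d → ℝ)).measurableEmbedding).2 (𝓕 Φ).integrable

lemma IsSchwartz.eq_integral_expChar_mul_ft (hf : IsSchwartz f) (x : Fin d → ℝ) :
    f x = ∫ ξ, expChar ξ x * ft f ξ := by
  obtain ⟨Φ, hΦ, hΦ'⟩ := hf.exists_schwartzMap
  have hinv : 𝓕⁻ (𝓕 Φ) = Φ := FourierTransform.fourierInv_fourier_eq Φ
  have hx : f x = 𝓕⁻ (𝓕 Φ) (WithLp.toLp 2 x) := by rw [hinv, hΦ]
  rw [hx, SchwartzMap.fourierInv_coe, Real.fourierInv_eq', ← integral_comp_toLp]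
  refine integral_congr_ae (Eventually.of_forall fun ξ => ?_)
  simp only [hΦ', smul_eq_mul, ← dotP_eq_inner, expChar]

end SchwartzInversion

section Torus

open UnitAddTorus

variable {d : ℕ}

/-- The unit circle with its normalized Haar measure. -/
local instance : MeasureSpace UnitAddCircle := ⟨AddCircle.haarAddCircle⟩

local instance : Measure.IsAddHaarMeasure (volume : Measure UnitAddCircle) :=
  inferInstanceAs (Measure.IsAddHaarMeasure AddCircle.haarAddCircle)

local instance : IsProbabilityMeasure (volume : Measure UnitAddCircle) :=
  inferInstanceAs (IsProbabilityMeasure AddCircle.haarAddCircle)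

/-- The half-open unit cube `(-1/2, 1/2]^d`. -/
def halfOpenCube (d : ℕ) : Set (Fin d → ℝ) :=
  {x | ∀ i, x i ∈ Ioc (-(1 / 2) : ℝ) (-(1 / 2) + 1)}

lemma measurableSet_halfOpenCube : MeasurableSet (halfOpenCube d) :=
  MeasurableSet.univ_pi' fun _ => measurableSet_Ioc

lemma measurableSet_centeredCube : MeasurableSet (centeredCube d) :=
  MeasurableSet.univ_pi fun _ => measurableSet_Ioo

lemma volume_centeredCube_lt_top : volume (centeredCube d) < ∞ := by
  rw [centeredCube, Real.volume_pi_Ioo]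
  exact ENNReal.prod_lt_top fun _ _ => ENNReal.ofReal_lt_top

lemma centeredCube_ae_eq_halfOpenCube : centeredCube d =ᵐ[volume] halfOpenCube d := by
  have e : halfOpenCube d = univ.pi fun _ => Ioc (-(1 / 2) : ℝ) (1 / 2) := by
    ext x
    norm_num [halfOpenCube]
  rw [e]
  exact Measure.univ_pi_Ioo_ae_eq_Icc.trans Measure.univ_pi_Ioc_ae_eq_Icc.symm

lemma mFourier_coe (n : Fin d → ℤ) (x : Fin d → ℝ) :
    mFourier n (fun i => (x i : UnitAddCircle)) = expChar x (intVec n) := by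
  simp only [mFourier, ContinuousMap.coe_mk, fourier_coe_apply, expChar, dotP, intVec]
  rw [← Complex.exp_sum]
  push_cast
  rw [Finset.mul_sum, Finset.sum_mul]
  congr 1
  refine Finset.sum_congr rfl fun i _ => ?_
  ring

lemma ae_halfOpenCube_of_ae_torus {p : UnitAddTorus (Fin d) → Prop} (hp : ∀ᵐ θ, p θ) :
    ∀ᵐ x ∂(volume.restrict (halfOpenCube d)), p fun i => (x i : UnitAddCircle) := by
  refine (ae_restrict_iff_subtype measurableSet_halfOpenCube).2 ?_
  exact (measurePreserving_equivPiIoc fun _ : Fin d => (-(1 / 2) : ℝ)).symm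
    |>.quasiMeasurePreserving.ae hp

lemma intVec_neg (k : Fin d → ℤ) : intVec (-k) = -intVec k := by
  ext i; simp [intVec]

/-- A bounded function on the unit cube with summable Fourier coefficients is almost everywhere
the sum of its Fourier series. -/
lemma ae_centeredCube_tsum_mul_expChar_eq {u : (Fin d → ℝ) → ℂ} (hu : Measurable u) {C : ℝ}
    (hC : ∀ η, ‖u η‖ ≤ C) {t : (Fin d → ℤ) → ℂ} (ht : Summable fun k => ‖t k‖)
    (htu : ∀ k, t k = ∫ η in centeredCube d, expChar η (intVec k) * u η) :
    ∀ᵐ η ∂(volume.restrict (centeredCube d)), ∑' k, t k * expChar η (-intVec k) = u η := by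
  let a : Fin d → ℝ := fun _ => -(1 / 2)
  let U : UnitAddTorus (Fin d) → ℂ := fun θ => u (measurableEquivPiIoc a θ).1
  have hUm : Measurable U :=
    hu.comp (measurable_subtype_coe.comp (measurableEquivPiIoc a).measurable)
  have hU : MemLp U 2 volume :=
    MemLp.of_bound hUm.aestronglyMeasurable C (Eventually.of_forall fun θ => hC _)
  have hUx : ∀ x ∈ halfOpenCube d, U (fun i => (x i : UnitAddCircle)) = u x := by
    intro x hx
    have := (measurableEquivPiIoc a).apply_symm_apply ⟨x, hx⟩
    simp only [U]
    rw [coe_symm_measurableEquivPiIoc_apply] at this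
    rw [this]
  have hcoef : ∀ n, mFourierCoeff (hU.toLp U) n = t (-n) := by
    intro n
    have h1 : mFourierCoeff (hU.toLp U) n = mFourierCoeff U n :=
      integral_congr_ae ((ae_eq_refl _).smul hU.coeFn_toLp)
    rw [h1, mFourierCoeff_eq_integral U n a, htu,
      setIntegral_congr_set centeredCube_ae_eq_halfOpenCube]
    refine setIntegral_congr_fun measurableSet_halfOpenCube fun x hx => ?_
    simp only [hUx x hx, mFourier_coe, smul_eq_mul]
  have hsum : Summable fun n : Fin d → ℤ => t (-n) • (mFourier n : C(UnitAddTorus (Fin d), ℂ)) := by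
    refine Summable.of_norm ?_
    simp only [norm_smul, mFourier_norm, mul_one]
    exact (Equiv.neg (Fin d → ℤ)).summable_iff.2 ht
  have h2 := hasSum_mFourier_series_L2 (hU.toLp U)
  have h3 := hsum.hasSum.mapL (ContinuousMap.toLp 2 (volume : Measure (UnitAddTorus (Fin d))) ℂ)
  simp only [map_smul] at h3
  simp only [hcoef] at h2
  have h4 := h2.unique h3
  have h5 : U =ᵐ[volume] _ := hU.coeFn_toLp.symm.trans
    ((congrArg (fun g : Lp ℂ 2 (volume : Measure (UnitAddTorus (Fin d))) =>
      (g : UnitAddTorus (Fin d) → ℂ)) h4).eventuallyEq.trans (ContinuousMap.coeFn_toLp volume _))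
  have h6 := ae_halfOpenCube_of_ae_torus h5
  rw [Measure.restrict_congr_set centeredCube_ae_eq_halfOpenCube]
  filter_upwards [h6, ae_restrict_mem measurableSet_halfOpenCube] with x hx hxm
  rw [← hUx x hxm, hx, ← ContinuousMap.tsum_apply hsum, ← (Equiv.neg (Fin d → ℤ)).tsum_eq]
  refine tsum_congr fun n => ?_
  simp [mFourier_coe, intVec_neg]

end Torus

section DiscreteRiesz

variable {d : ℕ} {b : Matrix (Fin d) (Fin d) ℝ} {ν : (Fin d → ℝ) → ℝ} {s : (Fin d → ℤ) → ℂ}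

lemma intVec_sub (k l : Fin d → ℤ) : intVec (k - l) = intVec k - intVec l := by
  ext i; simp [intVec]

/-- The Fourier series `Σ_k s_k e^{-2πi ηk}`. -/
def trigSeries (s : (Fin d → ℤ) → ℂ) (η : Fin d → ℝ) : ℂ :=
  ∑' k, s k * expChar η (-intVec k)

lemma continuous_trigSeries (hs : Summable fun k => ‖s k‖) : Continuous (trigSeries s) :=
  continuous_tsum (fun k => by fun_prop) hs fun k η => by simp

lemma norm_trigSeries_le (hs : Summable fun k => ‖s k‖) (η : Fin d → ℝ) :
    ‖trigSeries s η‖ ≤ ∑' k, ‖s k‖ :=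
  (norm_tsum_le_tsum_norm (by simpa using hs)).trans_eq (by simp)

lemma zetaFn_apply (ξ : Fin d → ℝ) (j : Fin d) :
    zetaFn b ν ξ j = rieszSymbol j (ξ ᵥ* b⁻¹) * (ν ξ : ℂ) := rfl

lemma measurable_rieszSymbol_vecMul (j : Fin d) (M : Matrix (Fin d) (Fin d) ℝ) :
    Measurable fun ξ : Fin d → ℝ => rieszSymbol j (ξ ᵥ* M) :=
  (measurable_rieszSymbol j).comp (by fun_prop : Continuous fun ξ : Fin d → ℝ => ξ ᵥ* M).measurable

lemma IsCutoff.exists_abs_le (hν : IsCutoff d ν) : ∃ C, ∀ ξ, |ν ξ| ≤ C := by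
  have hb : Bornology.IsBounded (centeredCube d) :=
    Bornology.IsBounded.pi fun _ => Metric.isBounded_Ioo _ _
  exact hν.smooth.continuous.bounded_above_of_compact_support
    (Metric.isCompact_of_isClosed_isBounded (isClosed_tsupport ν) (hb.subset hν.supp))

lemma IsCutoff.measurable_zetaFn (hν : IsCutoff d ν) (j : Fin d) :
    Measurable fun ξ => zetaFn b ν ξ j := by
  simp only [zetaFn_apply]
  exact (measurable_rieszSymbol_vecMul j _).mul
    (Complex.measurable_ofReal.comp hν.smooth.continuous.measurable)

lemma IsCutoff.exists_norm_zetaFn_le (hν : IsCutoff d ν) :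
    ∃ C, ∀ (j : Fin d) ξ, ‖zetaFn b ν ξ j‖ ≤ C := by
  obtain ⟨C, hC⟩ := hν.exists_abs_le
  refine ⟨C, fun j ξ => ?_⟩
  rw [zetaFn_apply, norm_mul, Complex.norm_real]
  exact (mul_le_of_le_one_left (norm_nonneg _) (norm_rieszSymbol_le j _)).trans (hC ξ)

lemma IsCutoff.integrableOn_zetaFn (hν : IsCutoff d ν) (j : Fin d) :
    IntegrableOn (fun ξ => zetaFn b ν ξ j) (centeredCube d) := by
  obtain ⟨C, hC⟩ := hν.exists_norm_zetaFn_le (b := b)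
  exact Measure.integrableOn_of_bounded volume_centeredCube_lt_top.ne
    (hν.measurable_zetaFn j).aestronglyMeasurable (Eventually.of_forall (hC j))

lemma IsCutoff.zKernel_apply (hν : IsCutoff d ν) (k : Fin d → ℤ) (j : Fin d) :
    zKernel b ν k j = ∫ ξ in centeredCube d, expChar ξ (intVec k) * zetaFn b ν ξ j := by
  have hi : ∀ i, IntegrableOn (fun ξ => (Complex.exp
      (((2 * Real.pi * ∑ i, ξ i * (k i : ℝ) : ℝ)) * Complex.I) • zetaFn b ν ξ) i)
      (centeredCube d) := by
    intro i
    have hc : Continuous fun ξ : Fin d → ℝ => expChar ξ (intVec k) := by fun_prop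
    exact (hν.integrableOn_zetaFn i).bdd_mul (c := 1) hc.aestronglyMeasurable
      (Eventually.of_forall fun ξ => (norm_expChar ξ (intVec k)).le)
  rw [zKernel, eval_integral hi]
  rfl

lemma IsCutoff.exists_norm_zKernel_le (hν : IsCutoff d ν) : ∃ C, ∀ k, ‖zKernel b ν k‖ ≤ C := by
  obtain ⟨C, hC⟩ := hν.exists_norm_zetaFn_le (b := b)
  refine ⟨max C 0 * volume.real (centeredCube d), fun k => ?_⟩
  refine (pi_norm_le_iff_of_nonneg (by positivity)).2 fun j => ?_
  rw [hν.zKernel_apply]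
  refine norm_setIntegral_le_of_norm_le_const volume_centeredCube_lt_top fun ξ _ => ?_
  simpa using Or.inl (hC j ξ)

/-- The discrete Riesz transform is the Fourier multiplier `ζ` on the unit cube. -/
lemma IsCutoff.dConv_zKernel_apply (hν : IsCutoff d ν) (hs : Summable fun k => ‖s k‖)
    (k : Fin d → ℤ) (j : Fin d) :
    dConv s (zKernel b ν) k j =
      ∫ η in centeredCube d, expChar η (intVec k) * (trigSeries s η * zetaFn b ν η j) := by
  obtain ⟨C, hC⟩ := hν.exists_norm_zKernel_le (b := b)
  have hsum : Summable fun l => s (k - l) • zKernel b ν l := by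
    refine Summable.of_norm_bounded (g := fun l => ‖s (k - l)‖ * C) ?_ fun l => ?_
    · exact ((Equiv.subLeft k).summable_iff.2 hs).mul_right C
    · rw [norm_smul]
      exact mul_le_mul_of_nonneg_left (hC l) (norm_nonneg _)
  have hc : ∀ m : Fin d → ℤ, Continuous fun ξ : Fin d → ℝ => s m * expChar ξ (intVec (k - m)) :=
    fun m => by fun_prop
  have hnorm : ∀ m (ξ : Fin d → ℝ), ‖s m * expChar ξ (intVec (k - m)) * zetaFn b ν ξ j‖ =
      ‖s m‖ * ‖zetaFn b ν ξ j‖ := fun m ξ => by simp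
  rw [dConv, tsum_apply hsum, ← (Equiv.subLeft k).tsum_eq]
  simp only [Equiv.subLeft_apply, sub_sub_cancel, Pi.smul_apply, smul_eq_mul, hν.zKernel_apply,
    ← integral_const_mul, ← mul_assoc]
  rw [integral_tsum_of_summable_integral_norm]
  · refine integral_congr_ae (Eventually.of_forall fun ξ => ?_)
    simp only [trigSeries]
    rw [tsum_mul_right, ← tsum_mul_left]
    congr 1
    refine tsum_congr fun m => ?_
    rw [intVec_sub, expChar_sub]
    ring
  · intro m
    exact (hν.integrableOn_zetaFn j).bdd_mul (c := ‖s m‖) (hc m).aestronglyMeasurable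
      (Eventually.of_forall fun ξ => by simp)
  · simp only [hnorm, integral_const_mul]
    exact hs.mul_right _

lemma summable_norm_apply {ι : Type*} {f : ι → Fin d → ℂ} (hf : Summable fun k => ‖f k‖)
    (j : Fin d) : Summable fun k => ‖f k j‖ :=
  Summable.of_nonneg_of_le (fun _ => norm_nonneg _) (fun k => norm_le_pi_norm (f k) j) hf

lemma IsCutoff.ae_trigSeries_dConv_eq (hν : IsCutoff d ν) (hs : Summable fun k => ‖s k‖)
    (hsz : Summable fun k => ‖dConv s (zKernel b ν) k‖) (j : Fin d) :
    ∀ᵐ η, η ∈ centeredCube d →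
      trigSeries (fun k => dConv s (zKernel b ν) k j) η = trigSeries s η * zetaFn b ν η j := by
  obtain ⟨C, hC⟩ := hν.exists_norm_zetaFn_le (b := b)
  refine (ae_restrict_iff' measurableSet_centeredCube).1 ?_
  refine ae_centeredCube_tsum_mul_expChar_eq
    ((continuous_trigSeries hs).measurable.mul (hν.measurable_zetaFn j))
    (C := (∑' k, ‖s k‖) * C) (fun η => ?_) (summable_norm_apply hsz j)
    (fun k => hν.dConv_zKernel_apply hs k j)
  rw [Pi.mul_apply, norm_mul]
  exact mul_le_mul (norm_trigSeries_le hs η) (hC j η) (norm_nonneg _)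
    (tsum_nonneg fun _ => norm_nonneg _)

lemma quasiMeasurePreserving_vecMul (hb : b.det ≠ 0) :
    Measure.QuasiMeasurePreserving (fun ξ : Fin d → ℝ => ξ ᵥ* b) volume volume := by
  have h : (fun ξ : Fin d → ℝ => ξ ᵥ* b) = Matrix.toLin' bᵀ := by
    ext ξ : 1
    simp [Matrix.mulVec_transpose]
  rw [h]
  exact Measure.LinearMap.quasiMeasurePreserving _ _ (by simpa using hb)

/-- Against a function whose spectrum lies in `C₀ b⁻¹`, the discrete Riesz transform acts as the
Riesz multiplier. -/
lemma IsCutoff.ae_trigSeries_dConv_vecMul_mul_eq (hν : IsCutoff d ν) (hb : b.det ≠ 0)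
    (hs : Summable fun k => ‖s k‖) (hsz : Summable fun k => ‖dConv s (zKernel b ν) k‖)
    {g : (Fin d → ℝ) → ℂ} (hg : Function.support g ⊆ {ξ | ξ ᵥ* b ∈ centeredCube d})
    (j : Fin d) :
    ∀ᵐ ξ, trigSeries (fun k => dConv s (zKernel b ν) k j) (ξ ᵥ* b) * g ξ =
      rieszSymbol j ξ * (trigSeries s (ξ ᵥ* b) * (g ξ * (ν (ξ ᵥ* b) : ℂ))) := by
  filter_upwards [(quasiMeasurePreserving_vecMul hb).ae (hν.ae_trigSeries_dConv_eq hs hsz j)]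
    with ξ hξ
  by_cases h : g ξ = 0
  · simp [h]
  · have hinv : (ξ ᵥ* b) ᵥ* b⁻¹ = ξ := by
      rw [Matrix.vecMul_vecMul, Matrix.mul_nonsing_inv _ (isUnit_iff_ne_zero.2 hb),
        Matrix.vecMul_one]
    rw [hξ (hg h), zetaFn_apply, hinv]
    ring

end DiscreteRiesz

section Convolution

variable {d : ℕ} {f g h : (Fin d → ℝ) → ℂ}

lemma integrable_mul_comp_sub (hf : Integrable f) (hg : Integrable g) :
    Integrable (fun p : (Fin d → ℝ) × (Fin d → ℝ) => f p.2 * g (p.1 - p.2))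
      (volume.prod volume) :=
  hf.convolution_integrand (ContinuousLinearMap.mul ℂ ℂ) hg

lemma integrable_conv (hf : Integrable f) (hg : Integrable g) : Integrable (conv f g) :=
  (integrable_mul_comp_sub hf hg).integral_prod_left

lemma integrable_mul_of_norm_le (hf : Integrable f) (hg : Measurable g) {C : ℝ}
    (hC : ∀ x, ‖g x‖ ≤ C) (x : Fin d → ℝ) : Integrable fun y => f y * g (x - y) :=
  hf.mul_bdd (c := C) (hg.comp (measurable_const.sub measurable_id)).aestronglyMeasurable
    (Eventually.of_forall fun _ => hC _)

lemma norm_conv_le {C : ℝ} (hf : Integrable f) (hC : ∀ x, ‖g x‖ ≤ C) (x : Fin d → ℝ) :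
    ‖conv f g x‖ ≤ (∫ y, ‖f y‖) * C := by
  rw [← integral_mul_const]
  refine norm_integral_le_of_norm_le (hf.norm.mul_const C) (Eventually.of_forall fun y => ?_)
  rw [norm_mul]
  exact mul_le_mul_of_nonneg_left (hC _) (norm_nonneg _)

lemma conv_assoc (hf : Integrable f) (hg : Integrable g) (hh : Measurable h) {C : ℝ}
    (hC : ∀ x, ‖h x‖ ≤ C) (x : Fin d → ℝ) : conv (conv f g) h x = conv f (conv g h) x := by
  have hm : Measurable fun p : (Fin d → ℝ) × (Fin d → ℝ) => h (x - p.1) :=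
    hh.comp (measurable_const.sub measurable_fst)
  have hi : Integrable (fun p : (Fin d → ℝ) × (Fin d → ℝ) =>
      f p.2 * g (p.1 - p.2) * h (x - p.1)) (volume.prod volume) :=
    (integrable_mul_comp_sub hf hg).mul_bdd (c := C) hm.aestronglyMeasurable
      (Eventually.of_forall fun _ => hC _)
  simp only [conv, ← integral_mul_const]
  rw [integral_integral_swap hi]
  refine integral_congr_ae (Eventually.of_forall fun w => ?_)
  simp only [mul_assoc, integral_const_mul]
  rw [← integral_add_right_eq_self (fun y => g (y - w) * h (x - y)) w]
  simp only [add_sub_cancel_right, sub_sub, add_comm w]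

lemma norm_conv_sub_le {L C : ℝ} (hf : Integrable f) (hg : Measurable g)
    (hC : ∀ x, ‖g x‖ ≤ C) (hL : ∀ x y, ‖g x - g y‖ ≤ L * ‖x - y‖) (x y : Fin d → ℝ) :
    ‖conv f g x - conv f g y‖ ≤ (∫ w, ‖f w‖) * L * ‖x - y‖ := by
  rw [conv, conv, ← integral_sub (integrable_mul_of_norm_le hf hg hC x)
    (integrable_mul_of_norm_le hf hg hC y), mul_assoc, ← integral_mul_const]
  refine norm_integral_le_of_norm_le (hf.norm.mul_const _) (Eventually.of_forall fun w => ?_)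
  rw [← mul_sub, norm_mul]
  refine mul_le_mul_of_nonneg_left ((hL _ _).trans_eq ?_) (norm_nonneg _)
  rw [sub_sub_sub_cancel_right]

lemma conv_eq_integral_expChar {γ : (Fin d → ℝ) → ℂ} (hf : Integrable f) (hγ : Integrable γ)
    (hg : ∀ x, g x = ∫ ξ, expChar ξ x * γ ξ) (x : Fin d → ℝ) :
    conv f g x = ∫ ξ, expChar ξ x * (ft f ξ * γ ξ) := by
  have hc : Continuous fun p : (Fin d → ℝ) × (Fin d → ℝ) => expChar p.2 (x - p.1) := by fun_prop
  have hi : Integrable (fun p : (Fin d → ℝ) × (Fin d → ℝ) =>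
      f p.1 * (expChar p.2 (x - p.1) * γ p.2)) (volume.prod volume) :=
    ((hf.mul_prod hγ).bdd_mul (c := 1) hc.aestronglyMeasurable
      (Eventually.of_forall fun p => by simp)).congr
      (Eventually.of_forall fun p => by ring)
  simp only [conv, hg, ← integral_const_mul]
  rw [integral_integral_swap hi]
  refine integral_congr_ae (Eventually.of_forall fun ξ => ?_)
  simp only [ft_eq_integral_expChar]
  rw [← integral_mul_const, ← integral_const_mul]
  refine integral_congr_ae (Eventually.of_forall fun y => ?_)
  simp only [expChar_sub]
  ring

end Convolution

section Synthesis

variable {d : ℕ} {b : Matrix (Fin d) (Fin d) ℝ} {s : (Fin d → ℤ) → ℂ} {f g : (Fin d → ℝ) → ℂ}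

/-- A series of integrable functions with summable `L¹` norms is integrable. -/
lemma integrable_tsum_of_summable_integral_norm {α ι E : Type*} [MeasurableSpace α]
    {μ : Measure α} [Countable ι] [NormedAddCommGroup E] [CompleteSpace E] {F : ι → α → E}
    (hF : ∀ i, Integrable (F i) μ) (hsum : Summable fun i => ∫ a, ‖F i a‖ ∂μ) :
    Integrable (fun a => ∑' i, F i a) μ := by
  have he : ∫⁻ a, ∑' i, ‖F i a‖ₑ ∂μ < ∞ := by
    rw [lintegral_tsum fun i => (hF i).1.enorm]
    have e : ∀ i, ∫⁻ a, ‖F i a‖ₑ ∂μ = ENNReal.ofReal (∫ a, ‖F i a‖ ∂μ) := fun i =>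
      (ofReal_integral_norm_eq_lintegral_enorm (hF i)).symm
    simp only [e]
    exact hsum.tsum_ofReal_lt_top
  have hae : ∀ᵐ a ∂μ, Summable fun i => F i a := by
    filter_upwards [ae_lt_top' (AEMeasurable.tsum fun i => (hF i).1.enorm) he.ne] with a ha
    refine Summable.of_norm ?_
    have := ENNReal.tsum_coe_ne_top_iff_summable.1 ha.ne
    exact NNReal.summable_coe.2 this
  refine ⟨aestronglyMeasurable_of_tendsto_ae (atTop : Filter (Finset ι))
    (f := fun t a => ∑ i ∈ t, F i a) (fun t => ?_) (hae.mono fun a ha => ha.hasSum), ?_⟩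
  · exact Finset.aestronglyMeasurable_fun_sum t fun i _ => (hF i).1
  · exact (lintegral_mono fun a => enorm_tsum_le_tsum_enorm).trans_lt he

lemma integrable_tsum_comp_sub_smul {ι E : Type*} [Countable ι] [NormedAddCommGroup E]
    [NormedSpace ℂ E] [CompleteSpace E] (hf : Integrable f) {t : ι → E} (p : ι → Fin d → ℝ)
    (ht : Summable fun k => ‖t k‖) : Integrable fun x => ∑' k, f (x - p k) • t k := by
  refine integrable_tsum_of_summable_integral_norm
    (fun k => (hf.comp_sub_right (p k)).smul_const (t k)) ?_
  have e : ∀ k, ∫ x, ‖f (x - p k) • t k‖ = (∫ x, ‖f x‖) * ‖t k‖ := fun k => by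
    simp only [norm_smul]
    rw [integral_mul_const, integral_sub_right_eq_self (fun x => ‖f x‖)]
  simp only [e]
  exact ht.mul_left _

/-- The synthesized function `Σ_k s_k f(x - bk)`. -/
def synth (b : Matrix (Fin d) (Fin d) ℝ) (s : (Fin d → ℤ) → ℂ) (f : (Fin d → ℝ) → ℂ)
    (x : Fin d → ℝ) : ℂ :=
  ∑' k, s k * f (x - b *ᵥ intVec k)

lemma integrable_synth (hf : Integrable f) (hs : Summable fun k => ‖s k‖) :
    Integrable (synth b s f) :=
  (integrable_tsum_comp_sub_smul hf (fun k => b *ᵥ intVec k) hs).congr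
    (Eventually.of_forall fun _ => tsum_congr fun _ => mul_comm _ _)

lemma summable_mul_of_norm_le {C : ℝ} (hC : ∀ x, ‖f x‖ ≤ C) (hs : Summable fun k => ‖s k‖)
    (p : (Fin d → ℤ) → Fin d → ℝ) : Summable fun k => s k * f (p k) :=
  Summable.of_norm_bounded (hs.mul_right C) fun k => by
    rw [norm_mul]
    exact mul_le_mul_of_nonneg_left (hC _) (norm_nonneg _)

lemma norm_synth_sub_le {C L : ℝ} (hC : ∀ x, ‖f x‖ ≤ C)
    (hL : ∀ x y, ‖f x - f y‖ ≤ L * ‖x - y‖) (hs : Summable fun k => ‖s k‖) (x y : Fin d → ℝ) :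
    ‖synth b s f x - synth b s f y‖ ≤ (∑' k, ‖s k‖) * L * ‖x - y‖ := by
  rw [synth, synth, ← (summable_mul_of_norm_le hC hs _).tsum_sub (summable_mul_of_norm_le hC hs _),
    mul_assoc, ← tsum_mul_right]
  refine tsum_of_norm_bounded (hs.mul_right _).hasSum fun k => ?_
  rw [← mul_sub, norm_mul]
  refine mul_le_mul_of_nonneg_left ((hL _ _).trans_eq ?_) (norm_nonneg _)
  rw [sub_sub_sub_cancel_right]

lemma synth_conv {C : ℝ} (hf : Integrable f) (hg : Measurable g) (hC : ∀ x, ‖g x‖ ≤ C)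
    (hs : Summable fun k => ‖s k‖) (x : Fin d → ℝ) :
    synth b s (conv f g) x = conv f (synth b s g) x := by
  simp only [synth, conv, ← integral_const_mul, ← tsum_mul_left]
  rw [integral_tsum_of_summable_integral_norm]
  · simp only [mul_left_comm, sub_right_comm]
  · exact fun k => (integrable_mul_of_norm_le hf hg hC _).const_mul _
  · refine Summable.of_nonneg_of_le (fun k => integral_nonneg fun _ => norm_nonneg _)
      (fun k => ?_) (hs.mul_right ((∫ y, ‖f y‖) * C))
    simp only [norm_mul (s k)]
    rw [integral_const_mul]
    refine mul_le_mul_of_nonneg_left ?_ (norm_nonneg _)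
    rw [← integral_mul_const]
    refine integral_mono (integrable_mul_of_norm_le hf hg hC _).norm (hf.norm.mul_const C)
      fun y => ?_
    rw [norm_mul]
    exact mul_le_mul_of_nonneg_left (hC _) (norm_nonneg _)

lemma synth_eq_integral_expChar {γ : (Fin d → ℝ) → ℂ} (hγ : Integrable γ)
    (hg : ∀ x, g x = ∫ ξ, expChar ξ x * γ ξ) (hs : Summable fun k => ‖s k‖) (x : Fin d → ℝ) :
    synth b s g x = ∫ ξ, expChar ξ x * (trigSeries s (ξ ᵥ* b) * γ ξ) := by
  have hn : ∀ k (ξ : Fin d → ℝ), ‖s k * (expChar ξ (x - b *ᵥ intVec k) * γ ξ)‖ =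
      ‖s k‖ * ‖γ ξ‖ := fun k ξ => by simp
  simp only [synth, hg, ← integral_const_mul]
  rw [integral_tsum_of_summable_integral_norm]
  · refine integral_congr_ae (Eventually.of_forall fun ξ => ?_)
    simp only [trigSeries]
    rw [← tsum_mul_right, ← tsum_mul_left]
    refine tsum_congr fun k => ?_
    rw [expChar_sub, ← expChar_mulVec, Matrix.mulVec_neg]
    ring
  · intro k
    have hc : Continuous fun ξ => expChar ξ (x - b *ᵥ intVec k) := by fun_prop
    exact (hγ.bdd_mul (c := 1) hc.aestronglyMeasurable
      (Eventually.of_forall fun ξ => by simp)).const_mul _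
  · simp only [hn, integral_const_mul]
    exact hs.mul_right _

end Synthesis

section TruncatedRiesz

variable {d : ℕ} {ψ f H K : (Fin d → ℝ) → ℂ} {L : ℝ}

/-- The `j`-th component of the Riesz kernel cut off at distance `ε` from the origin. -/
def truncKernel (j : Fin d) (ε : ℝ) : (Fin d → ℝ) → ℂ :=
  {y : Fin d → ℝ | ε < eucNorm y}.indicator fun y => (rieszKernel d y j : ℂ)

lemma measurable_truncKernel (j : Fin d) (ε : ℝ) : Measurable (truncKernel j ε) :=
  (measurable_rieszKernel j).complex_ofReal.indicator (measurableSet_lt_eucNorm ε)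

lemma norm_truncKernel_le (j : Fin d) {ε : ℝ} (hε : 0 < ε) (y : Fin d → ℝ) :
    ‖truncKernel j ε y‖ ≤ rieszConst d / ε ^ d := by
  by_cases hy : y ∈ {y : Fin d → ℝ | ε < eucNorm y}
  · rw [truncKernel, indicator_of_mem hy, Complex.norm_real]
    exact abs_rieszKernel_le_of_lt hε hy j
  · rw [truncKernel, indicator_of_notMem hy, norm_zero]
    exact div_nonneg rieszConst_pos.le (pow_nonneg hε.le d)

lemma truncRieszCoord_eq_conv (H : (Fin d → ℝ) → ℂ) (j : Fin d) (x : Fin d → ℝ) (ε : ℝ) :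
    truncRieszCoord H j x ε = conv H (truncKernel j ε) x := by
  rw [truncRieszCoord, ← integral_indicator (measurableSet_lt_eucNorm ε), conv,
    ← integral_sub_left_eq_self (fun y => H y * truncKernel j ε (x - y)) volume x]
  refine integral_congr_ae (Eventually.of_forall fun y => ?_)
  simp [truncKernel, indicator_mul_right]

lemma truncRiesz_apply (hf : Integrable f) (j : Fin d) (x : Fin d → ℝ) {ε : ℝ} (hε : 0 < ε) :
    truncRiesz f x ε j = truncRieszCoord f j x ε :=
  eval_integral (fun i => integrableOn_mul_rieszKernel (hf.comp_sub_left x) i hε) j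

/-- Convolution with an integrable function commutes with the Riesz transform of an integrable
Lipschitz function. -/
lemma tendsto_truncRieszCoord_conv (hψ : Integrable ψ) (j : Fin d) (hL0 : 0 ≤ L)
    (hL : ∀ x y, ‖H x - H y‖ ≤ L * ‖x - y‖) (hH : Integrable H)
    (hK : ∀ x, Tendsto (truncRieszCoord H j x) (𝓝[>] 0) (𝓝 (K x))) (x : Fin d → ℝ) :
    Tendsto (truncRieszCoord (conv ψ H) j x) (𝓝[>] 0) (𝓝 (conv ψ K x)) := by
  obtain ⟨B, hB⟩ := exists_norm_truncRieszCoord_le j hL0 hL hH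
  have hHc := continuous_of_norm_sub_le hL
  have hm : ∀ ε, Measurable fun x => truncRieszCoord H j x ε := by
    intro ε
    have h1 : StronglyMeasurable fun p : (Fin d → ℝ) × (Fin d → ℝ) =>
        H (p.1 - p.2) * (rieszKernel d p.2 j : ℂ) :=
      (((by fun_prop : Continuous fun p : (Fin d → ℝ) × (Fin d → ℝ) => H (p.1 - p.2)).measurable).mul
        ((measurable_rieszKernel j).complex_ofReal.comp measurable_snd)).stronglyMeasurable
    exact h1.integral_prod_right'.measurable
  have key : Tendsto (fun ε => ∫ w, ψ w * truncRieszCoord H j (x - w) ε) (𝓝[>] 0)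
      (𝓝 (∫ w, ψ w * K (x - w))) := by
    refine tendsto_integral_filter_of_dominated_convergence (fun w => ‖ψ w‖ * B)
      (Eventually.of_forall fun ε => hψ.aestronglyMeasurable.mul
        ((hm ε).comp (measurable_const.sub measurable_id)).aestronglyMeasurable)
      ?_ (hψ.norm.mul_const B) (Eventually.of_forall fun w => (hK (x - w)).const_mul (ψ w))
    filter_upwards [self_mem_nhdsWithin] with ε hε
    refine Eventually.of_forall fun w => ?_
    rw [norm_mul]
    exact mul_le_mul_of_nonneg_left (hB _ ε hε) (norm_nonneg _)
  refine key.congr' ?_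
  filter_upwards [self_mem_nhdsWithin] with ε hε
  rw [truncRieszCoord_eq_conv, conv_assoc hψ hH (measurable_truncKernel j ε)
    (norm_truncKernel_le j hε), conv]
  simp only [truncRieszCoord_eq_conv]

end TruncatedRiesz

section SynthesizedRiesz

variable {d : ℕ} {b : Matrix (Fin d) (Fin d) ℝ} {ν : (Fin d → ℝ) → ℝ} {s : (Fin d → ℤ) → ℂ}
  {ψ μ lam : (Fin d → ℝ) → ℂ}

/-- The Riesz transform of a synthesized Schwartz function `λ * μ` is synthesized from the
discrete Riesz transform of the coefficients. -/
lemma IsCutoff.tendsto_truncRieszCoord_synth_conv (hν : IsCutoff d ν) (hb : b.det ≠ 0)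
    (hμ : IsSchwartz μ) (hμft : ∀ ξ, ft μ ξ = (ν (ξ ᵥ* b) : ℂ)) (hlam : IsSchwartz lam)
    (hsupp : Function.support (ft lam) ⊆ {ξ | ξ ᵥ* b ∈ centeredCube d})
    (hs : Summable fun k => ‖s k‖) (hsz : Summable fun k => ‖dConv s (zKernel b ν) k‖)
    (j : Fin d) {L : ℝ} (hL0 : 0 ≤ L)
    (hL : ∀ x y, ‖synth b s (conv lam μ) x - synth b s (conv lam μ) y‖ ≤ L * ‖x - y‖)
    (x : Fin d → ℝ) :
    Tendsto (truncRieszCoord (synth b s (conv lam μ)) j x) (𝓝[>] 0)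
      (𝓝 (synth b (fun k => dConv s (zKernel b ν) k j) lam x)) := by
  obtain ⟨C, hC⟩ := hν.exists_abs_le
  have hγ : Integrable fun ξ => ft lam ξ * ft μ ξ :=
    hlam.integrable_ft.mul_bdd (c := C) hμ.continuous_ft.aestronglyMeasurable
      (Eventually.of_forall fun ξ => by simpa [hμft] using hC _)
  have ht : Continuous fun ξ : Fin d → ℝ => trigSeries s (ξ ᵥ* b) :=
    (continuous_trigSeries hs).comp (continuous_id.matrix_vecMul continuous_const)
  have hh : Integrable fun ξ => trigSeries s (ξ ᵥ* b) * (ft lam ξ * ft μ ξ) :=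
    hγ.bdd_mul ht.aestronglyMeasurable (Eventually.of_forall fun ξ => norm_trigSeries_le hs _)
  have hθ := conv_eq_integral_expChar hlam.integrable hμ.integrable_ft hμ.eq_integral_expChar_mul_ft
  have key := tendsto_truncRieszCoord j hL0 hL
    (integrable_synth (integrable_conv hlam.integrable hμ.integrable) hs) hh
    (synth_eq_integral_expChar hγ hθ hs) x
  rw [synth_eq_integral_expChar hlam.integrable_ft hlam.eq_integral_expChar_mul_ft
    (summable_norm_apply hsz j) x]
  convert key using 2
  refine integral_congr_ae ?_
  filter_upwards [hν.ae_trigSeries_dConv_vecMul_mul_eq hb hs hsz hsupp j] with ξ hξ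
  rw [hξ, hμft]

lemma IsCutoff.hasRiesz_synth (hν : IsCutoff d ν) (hb : b.det ≠ 0) (hψ : Integrable ψ)
    (hμ : IsSchwartz μ) (hμft : ∀ ξ, ft μ ξ = (ν (ξ ᵥ* b) : ℂ)) (hlam : IsSchwartz lam)
    (hsupp : Function.support (ft lam) ⊆ {ξ | ξ ᵥ* b ∈ centeredCube d})
    (hs : Summable fun k => ‖s k‖) (hsz : Summable fun k => ‖dConv s (zKernel b ν) k‖) :
    HasRiesz (synth b s (conv (conv ψ lam) μ))
      (fun x => ∑' k, conv ψ lam (x - b *ᵥ intVec k) • dConv s (zKernel b ν) k) := by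
  obtain ⟨Cμ, hCμ⟩ := hμ.exists_norm_le
  obtain ⟨Cl, hCl⟩ := hlam.exists_norm_le
  obtain ⟨L, hL0, hL⟩ := hμ.exists_norm_sub_le
  have hF : synth b s (conv (conv ψ lam) μ) = conv ψ (synth b s (conv lam μ)) := by
    rw [funext (conv_assoc hψ hlam.integrable hμ.continuous.measurable hCμ)]
    exact funext (synth_conv hψ
      (continuous_of_norm_sub_le (norm_conv_sub_le hlam.integrable
        hμ.continuous.measurable hCμ hL)).measurable
      (norm_conv_le hlam.integrable hCμ) hs)
  have hFi : Integrable (synth b s (conv (conv ψ lam) μ)) :=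
    integrable_synth (integrable_conv (integrable_conv hψ hlam.integrable) hμ.integrable) hs
  have hHL := norm_synth_sub_le (b := b) (norm_conv_le hlam.integrable hCμ)
    (norm_conv_sub_le hlam.integrable hμ.continuous.measurable hCμ hL) hs
  have hM0 : 0 ≤ (∑' k, ‖s k‖) * ((∫ w, ‖lam w‖) * L) :=
    mul_nonneg (tsum_nonneg fun _ => norm_nonneg _)
      (mul_nonneg (integral_nonneg fun _ => norm_nonneg _) hL0)
  refine Eventually.of_forall fun x => tendsto_pi_nhds.2 fun j => ?_
  have hsum : Summable fun k => conv ψ lam (x - b *ᵥ intVec k) • dConv s (zKernel b ν) k :=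
    Summable.of_norm_bounded (hsz.mul_left ((∫ y, ‖ψ y‖) * Cl)) fun k => by
      rw [norm_smul]
      exact mul_le_mul_of_nonneg_right (norm_conv_le hψ hCl _) (norm_nonneg _)
  have hlim : conv ψ (synth b (fun k => dConv s (zKernel b ν) k j) lam) x =
      (∑' k, conv ψ lam (x - b *ᵥ intVec k) • dConv s (zKernel b ν) k) j := by
    rw [← synth_conv hψ hlam.continuous.measurable hCl (summable_norm_apply hsz j), synth,
      tsum_apply hsum]
    exact tsum_congr fun k => mul_comm _ _
  beta_reduce
  rw [← hlim]
  refine (tendsto_truncRieszCoord_conv hψ j hM0 hHL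
    (integrable_synth (integrable_conv hlam.integrable hμ.integrable) hs)
    (hν.tendsto_truncRieszCoord_synth_conv hb hμ hμft hlam hsupp hs hsz j hM0 hHL) x).congr' ?_
  filter_upwards [self_mem_nhdsWithin] with ε hε
  rw [truncRiesz_apply hFi j x hε, hF]

end SynthesizedRiesz

/-- Lemma: Riesz transforms commute with synthesis.
Suppose `ψ ∈ L¹`, `ν` is the cut-off defining the discrete Riesz kernel `z`, `μ` is the
Schwartz function with `μ̂(ξ) = ν(ξ b)`, and `λ` is a Schwartz function with `λ̂`
supported in `C₀ b⁻¹` and `λ̂(0) = 1`.  If `s ∈ h¹`, then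
`Z * (Σ_k s_k (ψ*λ*μ)(· - bk)) = Σ_k (z*s)_k (ψ*λ)(· - bk) ∈ L¹`. -/
theorem statement11
    (d : ℕ) (b : Matrix (Fin d) (Fin d) ℝ) (hb : b.det ≠ 0)
    (ν : (Fin d → ℝ) → ℝ) (hν : IsCutoff d ν)
    (ψ : (Fin d → ℝ) → ℂ) (hψ : Integrable ψ volume)
    (μ : (Fin d → ℝ) → ℂ) (hμS : IsSchwartz μ)
    (hμft : ∀ ξ : Fin d → ℝ, ft μ ξ = ((ν (ξ ᵥ* b) : ℝ) : ℂ))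
    (lam : (Fin d → ℝ) → ℂ) (hlamS : IsSchwartz lam)
    (hlamsupp : Function.support (ft lam) ⊆ {ξ : Fin d → ℝ | ξ ᵥ* b ∈ centeredCube d})
    (hlam0 : ft lam 0 = 1)
    (s : (Fin d → ℤ) → ℂ)
    (hs1 : Summable fun k : Fin d → ℤ => ‖s k‖)
    (hs2 : Summable fun k : Fin d → ℤ => ‖dConv s (zKernel b ν) k‖) :
    Integrable
      (fun x => ∑' k : Fin d → ℤ, s k * conv (conv ψ lam) μ (x - b *ᵥ intVec k)) volume ∧
    Integrable
      (fun x => ∑' k : Fin d → ℤ,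
        conv ψ lam (x - b *ᵥ intVec k) • dConv s (zKernel b ν) k) volume ∧
    HasRiesz
      (fun x => ∑' k : Fin d → ℤ, s k * conv (conv ψ lam) μ (x - b *ᵥ intVec k))
      (fun x => ∑' k : Fin d → ℤ,
        conv ψ lam (x - b *ᵥ intVec k) • dConv s (zKernel b ν) k) := by
  exact ⟨integrable_synth (integrable_conv (integrable_conv hψ hlamS.integrable) hμS.integrable)
      hs1,
    integrable_tsum_comp_sub_smul (integrable_conv hψ hlamS.integrable) _ hs2,
    hν.hasRiesz_synth hb hψ hμS hμft hlamS hlamsupp hs1 hs2⟩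

end AffinePaper
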